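/- arXiv:1112.0689 — 13 statements merged into one kernel-verified Lean document; each statement's English description precedes it below -/
import Mathlib

section
/- Let U be a finite nonempty set, 𝓡 a nonempty family of subsets of U, k ≥ 1, and let OPT = max over k-tuples (S₁,…,S_k) of sets in 𝓡 of |S₁ ∪ ⋯ ∪ S_k|. Let c > 0 and δ > 0 satisfy 2δ ≤ c, and suppose OPT ≥ c·|U|. Let A ⊆ U be a nonempty set which is a δ-approximation of (U, 𝓡^{∪k}), i.e., for every k-tuple (R₁,…,R_k) of sets in 𝓡, | |A ∩ (R₁∪⋯∪R_k)|/|A| − |R₁∪⋯∪R_k|/|U| | ≤ δ. If (R₁,…,R_k) is a k-tuple of sets in 𝓡 maximizing |A ∩ (R₁ ∪ ⋯ ∪ R_k)|, then |R₁ ∪ ⋯ ∪ R_k| ≥ ((c − 2δ)/c) · OPT. -/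
/-- approximation transfer via a `δ`-approximation of `(U, 𝓡^{∪k})`.
If `OPT ≥ c·|U|`, `2δ ≤ c`, and `A` is a `δ`-approximation of `(U, 𝓡^{∪k})`, then a
`k`-tuple of sets of `𝓡` maximizing `|A ∩ (R₁ ∪ ⋯ ∪ R_k)|` satisfies
`|R₁ ∪ ⋯ ∪ R_k| ≥ ((c − 2δ)/c) · OPT`. -/
theorem statement1 {α : Type*} [DecidableEq α] (U : Finset α) (hU : U.Nonempty)
    (𝓡 : Finset (Finset α)) (h𝓡 : 𝓡.Nonempty) (hsub : ∀ R ∈ 𝓡, R ⊆ U)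
    (k : ℕ) (hk : 1 ≤ k) (OPT : ℕ)
    (hOPTub : ∀ S : Fin k → Finset α, (∀ i, S i ∈ 𝓡) → (Finset.univ.sup S).card ≤ OPT)
    (hOPTwit : ∃ S : Fin k → Finset α, (∀ i, S i ∈ 𝓡) ∧ (Finset.univ.sup S).card = OPT)
    (c δ : ℝ) (hc : 0 < c) (hδ : 0 < δ) (h2δ : 2 * δ ≤ c)
    (hOPTbig : (OPT : ℝ) ≥ c * U.card)
    (A : Finset α) (hAU : A ⊆ U) (hAne : A.Nonempty)
    (happrox : ∀ R : Fin k → Finset α, (∀ i, R i ∈ 𝓡) →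
      |((A ∩ Finset.univ.sup R).card : ℝ) / A.card
        - ((Finset.univ.sup R).card : ℝ) / U.card| ≤ δ)
    (R : Fin k → Finset α) (hR : ∀ i, R i ∈ 𝓡)
    (hmax : ∀ T : Fin k → Finset α, (∀ i, T i ∈ 𝓡) →
      (A ∩ Finset.univ.sup T).card ≤ (A ∩ Finset.univ.sup R).card) :
    ((Finset.univ.sup R).card : ℝ) ≥ ((c - 2 * δ) / c) * OPT := by
  obtain ⟨S, hS, hSOPT⟩ := hOPTwit
  have hu : (0 : ℝ) < U.card := by exact_mod_cast hU.card_pos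
  have hAR := (abs_le.mp (happrox R hR)).2
  have hAS := (abs_le.mp (happrox S hS)).1
  have hSR : ((A ∩ Finset.univ.sup S).card : ℝ) / A.card
      ≤ ((A ∩ Finset.univ.sup R).card : ℝ) / A.card :=
    div_le_div_of_nonneg_right (by exact_mod_cast hmax S hS) (Nat.cast_nonneg _)
  rw [hSOPT] at hAS
  have hratio : (OPT : ℝ) / U.card ≤ ((Finset.univ.sup R).card : ℝ) / U.card + 2 * δ := by
    linarith
  have hadd : (OPT : ℝ) ≤ (Finset.univ.sup R).card + 2 * δ * U.card := by
    rw [div_le_iff₀ hu, add_mul, div_mul_cancel₀ _ hu.ne'] at hratio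
    exact hratio
  have hUle : (U.card : ℝ) ≤ OPT / c := by
    rw [le_div_iff₀ hc]
    linarith
  have hloss : 2 * δ * U.card ≤ 2 * δ * (OPT / c) := by gcongr
  have hfactor : (c - 2 * δ) / c * OPT = OPT - 2 * δ * (OPT / c) := by
    field_simp
  linarith
end

section
/- Consider an instance of Constrained Maximum Coverage given by a finite universe U and k collections 𝓡₁, …, 𝓡_k of subsets of U. Let R₁, …, R_k be the sets selected by the greedy algorithm: R₁ is a maximum-cardinality set in 𝓡₁ and, for i ≥ 2, R_i ∈ 𝓡_i maximizes |R_i \ (R₁ ∪ ⋯ ∪ R_{i−1})|. Let S₁, …, S_k be any other solution with S_i ∈ 𝓡_i for each i, and set 𝐑 = R₁ ∪ ⋯ ∪ R_k and 𝐒 = S₁ ∪ ⋯ ∪ S_k. Then for every δ > 0, at least one of the following holds: (1) |𝐑| ≥ (1 − δ)|𝐒|, or (2) |𝐒 \ 𝐑| < (1 − δ)|𝐒|. -/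
/-- The marginal gains `R i \ ⋃ j < i, R j` are pairwise disjoint, so their cardinalities sum to at
most the cardinality of the union. -/
theorem sum_card_sdiff_sup_Iio_le {ι α : Type*} [Fintype ι] [LinearOrder ι]
    [LocallyFiniteOrderBot ι] [DecidableEq α] (R : ι → Finset α) :
    ∑ i, (R i \ (Finset.Iio i).sup R).card ≤ (Finset.univ.sup R).card := by
  have hlt : ∀ i j, i < j →
      Disjoint (R i \ (Finset.Iio i).sup R) (R j \ (Finset.Iio j).sup R) := fun i j hij =>
    Finset.disjoint_sdiff.mono_left
      (Finset.sdiff_subset.trans (Finset.le_sup (f := R) (Finset.mem_Iio.mpr hij)))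
  rw [← Finset.card_biUnion fun i _ j _ hij =>
    hij.lt_or_gt.elim (hlt i j) fun h => (hlt j i h).symm]
  exact Finset.card_le_card (Finset.biUnion_subset.mpr fun i hi =>
    Finset.sdiff_subset.trans (Finset.le_sup (f := R) hi))

/-- If each `R i` has marginal gain at least that of `S i`, then the part of the union of the `S i`
missed by the union of the `R i` is no larger than the latter. -/
theorem card_sup_sdiff_sup_le_of_greedy {ι α : Type*} [Fintype ι] [LinearOrder ι]
    [LocallyFiniteOrderBot ι] [DecidableEq α] (R S : ι → Finset α)
    (h : ∀ i, (S i \ (Finset.Iio i).sup R).card ≤ (R i \ (Finset.Iio i).sup R).card) :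
    (Finset.univ.sup S \ Finset.univ.sup R).card ≤ (Finset.univ.sup R).card := by
  have hsub : Finset.univ.sup S \ Finset.univ.sup R ⊆
      Finset.univ.biUnion fun i => S i \ (Finset.Iio i).sup R := by
    intro x hx
    obtain ⟨hxS, hxR⟩ := Finset.mem_sdiff.mp hx
    obtain ⟨i, hi, hxi⟩ := Finset.mem_sup.mp hxS
    exact Finset.mem_biUnion.mpr ⟨i, hi, Finset.mem_sdiff.mpr
      ⟨hxi, fun hx' => hxR (Finset.sup_mono (f := R) (Finset.subset_univ _) hx')⟩⟩
  calc (Finset.univ.sup S \ Finset.univ.sup R).card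
      ≤ ∑ i, (S i \ (Finset.Iio i).sup R).card :=
        (Finset.card_le_card hsub).trans Finset.card_biUnion_le
    _ ≤ ∑ i, (R i \ (Finset.Iio i).sup R).card := Finset.sum_le_sum fun i _ => h i
    _ ≤ (Finset.univ.sup R).card := sum_card_sdiff_sup_Iio_le R

/-- for the greedy algorithm for Constrained Maximum Coverage, with
greedy output `R₁,…,R_k` and any other solution `S₁,…,S_k`, for every `δ > 0`
either `|𝐑| ≥ (1−δ)|𝐒|` or `|𝐒 \ 𝐑| < (1−δ)|𝐒|`. -/
theorem statement2 {α : Type*} [DecidableEq α] (U : Finset α) (k : ℕ)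
    (𝓡 : Fin k → Finset (Finset α)) (hsub : ∀ i, ∀ R ∈ 𝓡 i, R ⊆ U)
    (R : Fin k → Finset α) (hRmem : ∀ i, R i ∈ 𝓡 i)
    (hgreedy : ∀ i, ∀ T ∈ 𝓡 i,
      (T \ (Finset.Iio i).sup R).card ≤ (R i \ (Finset.Iio i).sup R).card)
    (S : Fin k → Finset α) (hSmem : ∀ i, S i ∈ 𝓡 i)
    (δ : ℝ) (hδ : 0 < δ) :
    ((Finset.univ.sup R).card : ℝ) ≥ (1 - δ) * (Finset.univ.sup S).card ∨
    (((Finset.univ.sup S) \ (Finset.univ.sup R)).card : ℝ)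
      < (1 - δ) * (Finset.univ.sup S).card := by
  have hcard : (((Finset.univ.sup S) \ (Finset.univ.sup R)).card : ℝ)
      ≤ (Finset.univ.sup R).card :=
    mod_cast card_sup_sdiff_sup_le_of_greedy R S fun i => hgreedy i (S i) (hSmem i)
  exact (le_or_gt _ _).imp id hcard.trans_lt
end

section
/- Let (U, 𝓡, k) be an instance of weighted Maximum Coverage with weight function w : U → ℝ≥0, and suppose it has covering multiplicity r for some 1 ≤ r ≤ k: for every k-tuple a₁, …, a_k of sets in 𝓡 there exists an optimal solution (o₁, …, o_k) (a k-tuple of sets in 𝓡 maximizing the weight of the union, whose union is denoted OPT) such that each set a_i ∩ OPT, for 1 ≤ i ≤ k, is contained in the union of r elements of {o₁, …, o_k}. Let g₁, …, g_k be the sets chosen by the greedy algorithm, i.e., g_i ∈ 𝓡 maximizes w(g \ (g₁ ∪ ⋯ ∪ g_{i−1})) over g ∈ 𝓡. Then w(g₁ ∪ ⋯ ∪ g_k) ≥ (1 − (1 − 1/r)^r) · w(OPT). -/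
open Finset in
/-- If `k` rounds touch at most `r` parts each and every part has residual at most `d n` in round
`n`, then `r` times the total gain of the rounds is at least the residual at their start, provided
there are only `r * k` parts. -/
theorem sum_residual_le_mul_sum_gain {P : Type*} [Fintype P] [DecidableEq P] {k r a : ℕ}
    (hk : 1 ≤ k) (hP : Fintype.card P = r * k) (R : ℕ → P → ℝ) (d : ℕ → ℝ) (J : ℕ → Finset P)
    (hJ : ∀ n ∈ Ico a (a + k), (J n).card ≤ r)
    (hle : ∀ n ∈ Ico a (a + k), ∀ p, R n p ≤ d n)
    (hstay : ∀ n ∈ Ico a (a + k), ∀ p ∉ J n, R (n + 1) p = R n p) :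
    ∑ p, R a p ≤ r * ∑ n ∈ Ico a (a + k), d n := by
  obtain ⟨n₀, hn₀, hmin⟩ := (Ico a (a + k)).exists_min_image d ⟨a, by simp; omega⟩
  have hconst : ∀ p b, a ≤ b → b ≤ a + k → (∀ n ∈ Ico a b, p ∉ J n) → R b p = R a p := by
    intro p b hab
    induction b, hab using Nat.le_induction with
    | base => simp
    | succ b hab ih =>
      intro hb hn
      rw [hstay b (by simp; omega) p (hn b (by simp; omega))]
      exact ih (by omega) fun n h => hn n (by simp at h ⊢; omega)
  have hpart : ∀ p, R a p - d n₀ ≤ ∑ n ∈ Ico a (a + k), if p ∈ J n then d n - d n₀ else 0 := by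
    intro p
    have hnonneg : ∀ n ∈ Ico a (a + k), 0 ≤ if p ∈ J n then d n - d n₀ else 0 := by
      intro n hn
      split_ifs
      · linarith [hmin n hn]
      · rfl
    by_cases h : ∃ n, n ∈ Ico a (a + k) ∧ p ∈ J n
    · classical
      obtain ⟨hf, hfJ⟩ := Nat.find_spec h
      have hf' := mem_Ico.1 hf
      have heq := hconst p (Nat.find h) hf'.1 hf'.2.le fun n hn hpn =>
        Nat.find_min h (mem_Ico.1 hn).2
          ⟨mem_Ico.2 ⟨(mem_Ico.1 hn).1, (mem_Ico.1 hn).2.trans hf'.2⟩, hpn⟩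
      have hs := single_le_sum hnonneg hf
      rw [if_pos hfJ] at hs
      linarith [hle _ hf p]
    · push Not at h
      have hn₀' := mem_Ico.1 hn₀
      have heq := hconst p n₀ hn₀'.1 hn₀'.2.le fun n hn => h n (by simp at hn ⊢; omega)
      linarith [sum_nonneg hnonneg, hle n₀ hn₀ p]
  have hsum := sum_le_sum fun p (_ : p ∈ univ) => hpart p
  rw [sum_comm] at hsum
  have hround : ∀ n ∈ Ico a (a + k),
      (∑ p, if p ∈ J n then d n - d n₀ else 0) ≤ r * (d n - d n₀) := by
    intro n hn
    rw [← sum_filter, sum_const, nsmul_eq_mul, filter_mem_eq_inter, univ_inter]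
    exact mul_le_mul_of_nonneg_right (by exact_mod_cast hJ n hn) (by linarith [hmin n hn])
  have htotal := hsum.trans (sum_le_sum hround)
  simp only [sum_sub_distrib, ← mul_sum, sum_const, card_univ, hP, Nat.card_Ico,
    add_tsub_cancel_left, nsmul_eq_mul, Nat.cast_mul] at htotal
  linarith

open Finset in
/-- Iterating over `r` stages of `k` rounds each captures a `1 - (1 - 1/r)^r` fraction. -/
theorem le_sum_gain_of_stages {P : Type*} [Fintype P] [DecidableEq P] {k r : ℕ}
    (hk : 1 ≤ k) (hr : 1 ≤ r) (hP : Fintype.card P = r * k) (R : ℕ → P → ℝ) (d : ℕ → ℝ)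
    (J : ℕ → Finset P) (hJ : ∀ n < r * k, (J n).card ≤ r)
    (hle : ∀ n < r * k, ∀ p, R n p ≤ d n)
    (hstay : ∀ n < r * k, ∀ p ∉ J n, R (n + 1) p = R n p)
    (hgain : ∀ n < r * k, ∑ p, R n p ≤ ∑ p, R (n + 1) p + d n) :
    (1 - (1 - 1 / (r : ℝ)) ^ r) * ∑ p, R 0 p ≤ ∑ n ∈ range (r * k), d n := by
  have hr0 : (0 : ℝ) < r := by exact_mod_cast hr
  have hr1 : (0 : ℝ) ≤ 1 - 1 / (r : ℝ) := by
    rw [sub_nonneg, div_le_one hr0]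
    exact_mod_cast hr
  have hres : ∀ n ≤ r * k, ∑ p, R 0 p - ∑ i ∈ range n, d i ≤ ∑ p, R n p := by
    intro n
    induction n with
    | zero => simp
    | succ n ih =>
      intro hn
      rw [sum_range_succ]
      linarith [ih (by omega), hgain n (by omega)]
  have hstage : ∀ s ≤ r, ∑ p, R 0 p - ∑ i ∈ range (s * k), d i
      ≤ (1 - 1 / (r : ℝ)) ^ s * ∑ p, R 0 p := by
    intro s
    induction s with
    | zero => simp
    | succ s ih =>
      intro hs
      have hsk : s * k + k ≤ r * k := by
        rw [← Nat.succ_mul]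
        exact Nat.mul_le_mul_right k hs
      have hlt : ∀ n ∈ Ico (s * k) (s * k + k), n < r * k := fun n hn => by
        simp at hn
        omega
      have hwin := sum_residual_le_mul_sum_gain hk hP R d J (fun n hn => hJ n (hlt n hn))
        (fun n hn => hle n (hlt n hn)) (fun n hn => hstay n (hlt n hn))
      have hprev := ih (by omega)
      have hS := hres (s * k) (by omega)
      have hsplit := sum_range_add_sum_Ico d (Nat.le_add_right (s * k) k)
      rw [Nat.succ_mul, ← hsplit, pow_succ']
      have hdiv : (∑ p, R 0 p - ∑ i ∈ range (s * k), d i) * (1 / r)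
          ≤ ∑ n ∈ Ico (s * k) (s * k + k), d n := by
        rw [mul_one_div, div_le_iff₀ hr0]
        linarith
      have hmul := mul_le_mul_of_nonneg_left hprev hr1
      linarith
  linarith [hstage r le_rfl]

theorem add_sub_div_of_ne_mod {n r c : ℕ} (hc : c < r) (h : c ≠ n % r) :
    (n + 1 + (r - 1 - c)) / r = (n + (r - 1 - c)) / r := by
  have hn := Nat.div_add_mod n r
  have ht := Nat.mod_lt n (by omega : 0 < r)
  have key : ∀ t, t < r → (r * (n / r) + t) / r = n / r := fun t h => by
    rw [Nat.mul_add_div (by omega), Nat.div_eq_of_lt h, add_zero]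
  have key' : ∀ t, t < r → (r * (n / r) + r + t) / r = n / r + 1 := fun t h => by
    rw [← Nat.mul_succ, Nat.mul_add_div (by omega), Nat.div_eq_of_lt h, add_zero]
  rcases lt_or_gt_of_ne h with h | h
  · rw [show n + 1 + (r - 1 - c) = r * (n / r) + r + (n % r - c) by omega,
      show n + (r - 1 - c) = r * (n / r) + r + (n % r - c - 1) by omega,
      key' _ (by omega), key' _ (by omega)]
  · rw [show n + 1 + (r - 1 - c) = r * (n / r) + (n % r + r - c) by omega,
      show n + (r - 1 - c) = r * (n / r) + (n % r + r - 1 - c) by omega,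
      key _ (by omega), key _ (by omega)]

theorem add_sub_mod_div {n r : ℕ} (hr : 0 < r) : (n + (r - 1 - n % r)) / r = n / r := by
  have hn := Nat.div_add_mod n r
  have ht := Nat.mod_lt n hr
  rw [show n + (r - 1 - n % r) = r * (n / r) + (r - 1) by omega, Nat.mul_add_div hr,
    Nat.div_eq_of_lt (Nat.sub_one_lt_of_lt hr), add_zero]

theorem add_one_add_sub_mod_div {n r : ℕ} (hr : 0 < r) :
    (n + 1 + (r - 1 - n % r)) / r = n / r + 1 := by
  have hn := Nat.div_add_mod n r
  have ht := Nat.mod_lt n hr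
  rw [show n + 1 + (r - 1 - n % r) = r * (n / r) + r by omega, ← Nat.mul_succ,
    Nat.mul_div_cancel_left _ hr]

open Finset in
/-- The stage bound for `k` rounds and `k` parts, where `r` need not divide `k`: take `r` copies of
every part and of every round. -/
theorem le_sum_gain_of_touch_le {k r : ℕ} (hk : 1 ≤ k) (hr : 1 ≤ r) (R : ℕ → Fin k → ℝ)
    (d : ℕ → ℝ) (J : ℕ → Finset (Fin k)) (hJ : ∀ n < k, (J n).card ≤ r)
    (hanti : ∀ j, Antitone fun n => R n j) (hle : ∀ n < k, ∀ j, R n j ≤ d n)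
    (hstay : ∀ n < k, ∀ j ∉ J n, R (n + 1) j = R n j)
    (hgain : ∀ n < k, ∑ j, R n j ≤ ∑ j, R (n + 1) j + d n) :
    (1 - (1 - 1 / (r : ℝ)) ^ r) * ∑ j, R 0 j ≤ ∑ n ∈ range k, d n := by
  have hr0 : (0 : ℝ) < r := by exact_mod_cast hr
  have hdiv : ∀ n < r * k, n / r < k := fun n hn => Nat.div_lt_of_lt_mul hn
  have hcopies := le_sum_gain_of_stages (P := Fin k × Fin r) hk hr (by simp [mul_comm])
    (fun n p => R ((n + (r - 1 - p.2)) / r) p.1) (fun n => d (n / r))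
    (fun n => J (n / r) ×ˢ {⟨n % r, Nat.mod_lt n hr⟩})
    (fun n hn => by simpa using hJ _ (hdiv n hn))
    (fun n hn p => (hanti p.1 (Nat.div_le_div_right (Nat.le_add_right _ _))).trans
      (hle _ (hdiv n hn) _)) ?_ ?_
  · have h0 : ∑ p : Fin k × Fin r, R ((0 + (r - 1 - p.2)) / r) p.1 = r * ∑ j, R 0 j := by
      rw [Fintype.sum_prod_type, mul_sum]
      refine sum_congr rfl fun j _ => ?_
      have hzero : ∀ c : Fin r, (0 + (r - 1 - (c : ℕ))) / r = 0 := fun c =>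
        Nat.div_eq_of_lt (by omega)
      simp only [hzero, sum_const, card_univ, Fintype.card_fin, nsmul_eq_mul]
    have hd : ∀ m, ∑ n ∈ range (r * m), d (n / r) = r * ∑ n ∈ range m, d n := by
      intro m
      induction m with
      | zero => simp
      | succ m ih =>
        rw [Nat.mul_succ, sum_range_add, ih, sum_range_succ, mul_add]
        congr 1
        rw [sum_congr rfl fun t ht => by
          rw [Nat.mul_add_div hr, Nat.div_eq_of_lt (mem_range.1 ht), add_zero]]
        simp
    rw [h0, hd, mul_left_comm] at hcopies
    exact le_of_mul_le_mul_left hcopies hr0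
  · rintro n hn ⟨j, c⟩ hp
    simp only [mem_product, mem_singleton, Fin.ext_iff, not_and] at hp
    by_cases hc : (c : ℕ) = n % r
    · simp only [hc, add_sub_mod_div hr, add_one_add_sub_mod_div hr]
      exact hstay _ (hdiv n hn) j fun h => hp h hc
    · simp only [add_sub_div_of_ne_mod c.2 hc]
  · intro n hn
    rw [Fintype.sum_prod_type_right, Fintype.sum_prod_type_right]
    let c₀ : Fin r := ⟨n % r, Nat.mod_lt n hr⟩
    rw [← add_sum_erase univ _ (mem_univ c₀), ← add_sum_erase univ _ (mem_univ c₀)]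
    have hrest : ∀ c ∈ univ.erase c₀, ∑ j, R ((n + (r - 1 - (c : ℕ))) / r) j
        = ∑ j, R ((n + 1 + (r - 1 - (c : ℕ))) / r) j := by
      intro c hc
      rw [add_sub_div_of_ne_mod c.2 fun h => ne_of_mem_erase hc (Fin.ext h)]
    rw [sum_congr rfl hrest]
    have := hgain _ (hdiv n hn)
    simp only [c₀, add_sub_mod_div hr, add_one_add_sub_mod_div hr]
    linarith

/-- the greedy algorithm is a `1 − (1 − 1/r)^r` approximation for
weighted Maximum Coverage with covering multiplicity `r`. -/
theorem statement5 {α : Type*} [DecidableEq α] (U : Finset α)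
    (𝓡 : Finset (Finset α)) (h𝓡 : 𝓡.Nonempty) (hsub : ∀ R ∈ 𝓡, R ⊆ U)
    (k : ℕ) (hk : 1 ≤ k) (w : α → ℝ) (hw : ∀ x, 0 ≤ w x)
    (r : ℕ) (hr1 : 1 ≤ r) (hrk : r ≤ k)
    -- covering multiplicity `r`:
    (hmult : ∀ a : Fin k → Finset α, (∀ i, a i ∈ 𝓡) →
      ∃ o : Fin k → Finset α, (∀ i, o i ∈ 𝓡) ∧
        (∀ S : Fin k → Finset α, (∀ i, S i ∈ 𝓡) →
          ∑ x ∈ Finset.univ.sup S, w x ≤ ∑ x ∈ Finset.univ.sup o, w x) ∧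
        (∀ i : Fin k, ∃ J : Finset (Fin k), J.card ≤ r ∧
          a i ∩ Finset.univ.sup o ⊆ J.sup o))
    -- greedy choices:
    (g : Fin k → Finset α) (hgmem : ∀ i, g i ∈ 𝓡)
    (hgreedy : ∀ i, ∀ T ∈ 𝓡,
      ∑ x ∈ T \ (Finset.Iio i).sup g, w x ≤ ∑ x ∈ g i \ (Finset.Iio i).sup g, w x) :
    ∀ S : Fin k → Finset α, (∀ i, S i ∈ 𝓡) →
      ∑ x ∈ Finset.univ.sup g, w x ≥
        (1 - (1 - 1 / (r : ℝ)) ^ r) * ∑ x ∈ Finset.univ.sup S, w x := by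
  classical
  intro S hS
  obtain ⟨o, ho, hopt, hcov⟩ := hmult g hgmem
  choose J hJcard hJcov using hcov
  set OPT := Finset.univ.sup o
  have hr0 : (0 : ℝ) < r := by exact_mod_cast hr1
  have hinv : 1 / (r : ℝ) ≤ 1 := by
    rw [div_le_one hr0]
    exact_mod_cast hr1
  have hratio : 0 ≤ 1 - (1 - 1 / (r : ℝ)) ^ r :=
    sub_nonneg.2 (pow_le_one₀ (sub_nonneg.2 hinv) (sub_le_self _ (by positivity)))
  refine ge_iff_le.2 ((mul_le_mul_of_nonneg_left (hopt S hS) hratio).trans ?_)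
  -- `G n` is the union of the first `n` greedy sets.
  let G : ℕ → Finset α := fun n => (Finset.univ.filter fun l : Fin k => (l : ℕ) < n).sup g
  have hmemG : ∀ n x, x ∈ G n ↔ ∃ l : Fin k, (l : ℕ) < n ∧ x ∈ g l := by
    intro n x
    simp [G, Finset.mem_sup]
  have hGIio : ∀ i : Fin k, (Finset.Iio i).sup g = G i := by
    intro i
    ext x
    rw [hmemG]
    simp [Finset.mem_sup]
  have hGsucc : ∀ i : Fin k, G (i + 1) = G i ∪ g i := by
    intro i
    ext x
    simp only [Finset.mem_union, hmemG, Nat.lt_succ_iff_lt_or_eq, or_and_right, exists_or,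
      ← Fin.ext_iff, exists_eq_left]
  have hGmono : Monotone G := fun m n hmn x hx => by
    rw [hmemG] at hx ⊢
    obtain ⟨l, hl, hxl⟩ := hx
    exact ⟨l, hl.trans_le hmn, hxl⟩
  -- Every element of the optimum is assigned to an optimal set that its first cover touches.
  have hassign : ∀ x, ∃ j : Fin k, x ∈ OPT →
      x ∈ o j ∧ ∀ i : Fin k, x ∈ g i → x ∉ G i → j ∈ J i := by
    intro x
    by_cases hx : x ∈ OPT
    · by_cases h : ∃ i : Fin k, x ∈ g i ∧ x ∉ G i
      · obtain ⟨i, hxi, hxG⟩ := h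
        obtain ⟨j, hj, hxj⟩ := Finset.mem_sup.1 (hJcov i (Finset.mem_inter.2 ⟨hxi, hx⟩))
        refine ⟨j, fun _ => ⟨hxj, fun i' hxi' hxG' => ?_⟩⟩
        rw [hmemG] at hxG hxG'
        push Not at hxG hxG'
        have hii : i' = i := le_antisymm
          (not_lt.1 fun h => hxG' i h hxi) (not_lt.1 fun h => hxG i' h hxi')
        rwa [hii]
      · obtain ⟨j, _, hxj⟩ := Finset.mem_sup.1 hx
        exact ⟨j, fun _ => ⟨hxj, fun i hxi hxG => (h ⟨i, hxi, hxG⟩).elim⟩⟩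
    · exact ⟨⟨0, hk⟩, fun h => (hx h).elim⟩
  choose a ha using hassign
  let part : ℕ → Fin k → Finset α := fun n j => (OPT \ G n).filter fun x => a x = j
  let d : ℕ → ℝ := fun n => if h : n < k then ∑ x ∈ g ⟨n, h⟩ \ G n, w x else 0
  have hfiber : ∀ n, ∑ j, ∑ x ∈ part n j, w x = ∑ x ∈ OPT \ G n, w x := fun n =>
    Finset.sum_fiberwise _ _ _
  have hmonoSum : ∀ {s t : Finset α}, s ⊆ t → ∑ x ∈ s, w x ≤ ∑ x ∈ t, w x := fun h =>
    Finset.sum_le_sum_of_subset_of_nonneg h fun x _ _ => hw x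
  have hbound := le_sum_gain_of_touch_le hk hr1 (fun n j => ∑ x ∈ part n j, w x) d
    (fun n => if h : n < k then J ⟨n, h⟩ else ∅)
    (fun n hn => by simpa [hn] using hJcard ⟨n, hn⟩)
    (fun j m n hmn => hmonoSum (Finset.filter_subset_filter _
      (Finset.sdiff_subset_sdiff subset_rfl (hGmono hmn)))) ?_ ?_ ?_
  · have hG0 : G 0 = ∅ := by simp [G]
    have hGk : G k = Finset.univ.sup g := by simp [G]
    have hsum : ∀ n ≤ k, ∑ i ∈ Finset.range n, d i = ∑ x ∈ G n, w x := by
      intro n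
      induction n with
      | zero => simp [hG0]
      | succ n ih =>
        intro hn
        have hs := hGsucc ⟨n, hn⟩
        simp only at hs
        rw [Finset.sum_range_succ, ih (by omega), hs, ← Finset.union_sdiff_self_eq_union,
          Finset.sum_union Finset.disjoint_sdiff]
        simp [d, Nat.lt_of_succ_le hn]
    rw [hfiber, hG0, Finset.sdiff_empty, hsum k le_rfl, hGk] at hbound
    exact hbound
  · intro n hn j
    have hgr := hgreedy ⟨n, hn⟩ (o j) (ho j)
    rw [hGIio] at hgr
    simp only [d, hn, dif_pos]
    refine (hmonoSum fun x hx => ?_).trans hgr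
    obtain ⟨hx, hxj⟩ := Finset.mem_filter.1 hx
    obtain ⟨hxO, hxG⟩ := Finset.mem_sdiff.1 hx
    exact Finset.mem_sdiff.2 ⟨hxj ▸ (ha x hxO).1, hxG⟩
  · intro n hn j hj
    simp only [hn, dif_pos] at hj
    have hs := hGsucc ⟨n, hn⟩
    simp only at hs
    have : part (n + 1) j = part n j := by
      ext x
      simp only [part, hs, Finset.mem_filter, Finset.mem_sdiff, Finset.mem_union, not_or]
      constructor
      · rintro ⟨⟨hxO, hxG, _⟩, hxj⟩
        exact ⟨⟨hxO, hxG⟩, hxj⟩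
      · rintro ⟨⟨hxO, hxG⟩, hxj⟩
        exact ⟨⟨hxO, hxG, fun hxg => hj (hxj ▸ (ha x hxO).2 ⟨n, hn⟩ hxg hxG)⟩, hxj⟩
    simp only [this]
  · intro n hn
    have hs := hGsucc ⟨n, hn⟩
    simp only at hs
    simp only [hfiber, d, hn, dif_pos, hs]
    have hdisj : Disjoint (OPT \ (G n ∪ g ⟨n, hn⟩)) (g ⟨n, hn⟩ \ G n) := by
      rw [Finset.disjoint_left]
      intro x hx hx'
      simp only [Finset.mem_sdiff, Finset.mem_union] at hx hx'
      tauto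
    rw [← Finset.sum_union hdisj]
    refine hmonoSum fun x hx => ?_
    simp only [Finset.mem_sdiff, Finset.mem_union] at hx ⊢
    tauto
end

section
/- Let (U, 𝓡, k) be an instance of weighted Maximum Coverage with weight function w : U → ℝ≥0 in which every set R ∈ 𝓡 has cardinality at most r, where 1 ≤ r ≤ k. Let g₁, …, g_k be the sets chosen by the greedy algorithm, i.e., g_i ∈ 𝓡 maximizes w(g \ (g₁ ∪ ⋯ ∪ g_{i−1})) over g ∈ 𝓡. Then w(g₁ ∪ ⋯ ∪ g_k) ≥ (1 − (1 − 1/r)^r) times the maximum, over k-tuples (S₁,…,S_k) of sets in 𝓡, of w(S₁ ∪ ⋯ ∪ S_k). -/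
/-- The weight `1 - (1 - 1/r)^n` given to the residual of an optimal set whose level is `n`. -/
noncomputable def levelWeight (r n : ℕ) : ℝ := 1 - (1 - 1 / (r : ℝ)) ^ n

section levelWeight

variable {r : ℕ}

lemma one_sub_inv_mem (hr : 1 ≤ r) :
    0 ≤ 1 - 1 / (r : ℝ) ∧ 1 - 1 / (r : ℝ) ≤ 1 := by
  have h : (1 : ℝ) ≤ r := by exact_mod_cast hr
  have h1 : 1 / (r : ℝ) ≤ 1 := by rw [div_le_one (by linarith)]; exact h
  have h2 : 0 ≤ 1 / (r : ℝ) := by positivity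
  constructor <;> linarith

lemma levelWeight_zero : levelWeight r 0 = 0 := by simp [levelWeight]

lemma levelWeight_succ (n : ℕ) :
    levelWeight r (n + 1) = levelWeight r n + (1 - levelWeight r n) / r := by
  simp only [levelWeight, pow_succ]; ring

lemma levelWeight_le_one (hr : 1 ≤ r) (n : ℕ) : levelWeight r n ≤ 1 := by
  have := pow_nonneg (one_sub_inv_mem hr).1 n
  simp only [levelWeight]; linarith

lemma levelWeight_mono (hr : 1 ≤ r) : Monotone (levelWeight r) := by
  refine monotone_nat_of_le_succ fun n => ?_
  rw [levelWeight_succ]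
  have : 0 ≤ (1 - levelWeight r n) / r :=
    div_nonneg (by linarith [levelWeight_le_one hr n]) (by positivity)
  linarith

lemma levelWeight_nonneg (hr : 1 ≤ r) (n : ℕ) : 0 ≤ levelWeight r n := by
  simpa [levelWeight_zero] using levelWeight_mono hr (Nat.zero_le n)

lemma levelWeight_sub_le (hr : 1 ≤ r) {m n : ℕ} (h : m ≤ n) :
    levelWeight r n - levelWeight r m ≤ ((n : ℝ) - m) / r := by
  induction n, h using Nat.le_induction with
  | base => simp
  | succ n _ ih =>
    have h1 : (1 - levelWeight r n) / r ≤ 1 / r :=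
      div_le_div_of_nonneg_right (by linarith [levelWeight_nonneg hr n]) (by positivity)
    rw [levelWeight_succ]
    push_cast
    have : ((n : ℝ) + 1 - m) / r = (n - m) / r + 1 / r := by ring
    linarith

end levelWeight

/-- Some `n`-element subset carries at least its proportional share of a sum. -/
lemma exists_subset_card_mul_sum_le {ι : Type*} [DecidableEq ι] (c : ι → ℝ) (N : Finset ι)
    (n : ℕ) (hn : n ≤ N.card) :
    ∃ Q ⊆ N, Q.card = n ∧ (n : ℝ) * ∑ j ∈ N, c j ≤ N.card * ∑ j ∈ Q, c j := by
  induction hn using Nat.decreasingInduction with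
  | self => exact ⟨N, subset_rfl, rfl, le_rfl⟩
  | of_succ n hn ih =>
    obtain ⟨Q, hQN, hQ, hle⟩ := ih
    obtain ⟨j, hj, hmin⟩ := Q.exists_min_image c (Finset.card_pos.1 (by omega))
    refine ⟨Q.erase j, (Finset.erase_subset _ _).trans hQN, by
      rw [Finset.card_erase_of_mem hj, hQ]; rfl, ?_⟩
    have h1 : ∑ i ∈ Q.erase j, c i + c j = ∑ i ∈ Q, c i := Finset.sum_erase_add _ _ hj
    have h2 : ((n : ℝ) + 1) * c j ≤ ∑ i ∈ Q, c i := by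
      have := Finset.card_nsmul_le_sum Q c (c j) hmin
      rw [hQ, nsmul_eq_mul] at this
      exact_mod_cast this
    push_cast at hle
    have hN : (0 : ℝ) ≤ N.card := by positivity
    have h3 : (N.card : ℝ) * (n * ∑ i ∈ Q, c i) ≤
        N.card * ((n + 1) * ∑ i ∈ Q.erase j, c i) :=
      mul_le_mul_of_nonneg_left (by nlinarith) hN
    have h4 := mul_le_mul_of_nonneg_left hle (Nat.cast_nonneg (α := ℝ) n)
    have h5 : (0 : ℝ) < n + 1 := by positivity
    refine le_of_mul_le_mul_left ?_ h5
    linarith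

lemma exists_le_sum_eq {ι : Type*} [DecidableEq ι] (T : Finset ι) (u : ι → ℕ) (n : ℕ)
    (hn : n ≤ ∑ j ∈ T, u j) : ∃ v ≤ u, ∑ j ∈ T, v j = n := by
  induction hn using Nat.decreasingInduction with
  | self => exact ⟨u, le_rfl, rfl⟩
  | of_succ n hn ih =>
    obtain ⟨v, hv, hs⟩ := ih
    obtain ⟨j, hj, hpos⟩ : ∃ j ∈ T, v j ≠ 0 := Finset.exists_ne_zero_of_sum_ne_zero (by omega)
    refine ⟨Function.update v j (v j - 1), fun i => ?_, ?_⟩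
    · by_cases hi : i = j
      · subst hi; simpa using (Nat.le_succ_of_le (hv i))
      · simpa [hi] using hv i
    · have h1 := Finset.sum_update_of_mem hj v (v j - 1)
      have h2 := Finset.sum_eq_add_sum_sdiff_singleton_of_mem hj v
      omega

/-- Lowering `n` level units inside `T`, always from the top, costs at most
`a * (1 - (1 - n / r) * (1 - 1 / r) ^ M)` when all levels in `T` are at most `M`. -/
lemma exists_lower_levels {ι : Type*} [DecidableEq ι] {r : ℕ} (hr : 1 ≤ r) (T : Finset ι)
    (hT : T.card ≤ r) (c : ι → ℝ) (hc : ∀ j, 0 ≤ c j) (a : ℝ) (hca : ∑ j ∈ T, c j ≤ a)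
    (M : ℕ) : ∀ (s : ι → ℕ) (n : ℕ), (∀ j ∈ T, s j ≤ M) → n ≤ r → n ≤ ∑ j ∈ T, s j →
      ∃ s' ≤ s, ∑ j ∈ T, s' j + n = ∑ j ∈ T, s j ∧
        a * ∑ j ∈ T, (levelWeight r (s j) - levelWeight r (s' j)) +
          ∑ j ∈ T, c j * levelWeight r (s' j) ≤
            a * (1 - (1 - n / r) * (1 - levelWeight r M)) := by
  have ha : 0 ≤ a := (Finset.sum_nonneg fun j _ => hc j).trans hca
  have hr0 : (0 : ℝ) < r := by exact_mod_cast hr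
  induction M with
  | zero =>
    intro s n hs _ hn
    have hs0 : ∀ j ∈ T, s j = 0 := fun j hj => Nat.le_zero.1 (hs j hj)
    have hn0 : n = 0 := by rw [Finset.sum_eq_zero hs0] at hn; omega
    refine ⟨s, le_rfl, by omega, ?_⟩
    rw [Finset.sum_eq_zero (s := T) (f := fun j => c j * levelWeight r (s j))
      fun j hj => by rw [hs0 j hj, levelWeight_zero, mul_zero]]
    simp [hn0, levelWeight_zero]
  | succ M ih =>
    intro s n hs hnr hn
    have hnr' : (n : ℝ) / r ≤ 1 := by rw [div_le_one hr0]; exact_mod_cast hnr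
    have hM1 : 0 ≤ 1 - levelWeight r M := by linarith [levelWeight_le_one hr M]
    have hM0 := levelWeight_nonneg hr M
    set N := T.filter fun j => s j = M + 1 with hN
    -- lowering a subset of `N` by one
    have key : ∀ Q ⊆ N, ∃ s₁ ≤ s, (∀ j, s₁ j = if j ∈ Q then M else s j) ∧
        ∑ j ∈ T, s₁ j + Q.card = ∑ j ∈ T, s j ∧
        ∑ j ∈ T, (levelWeight r (s j) - levelWeight r (s₁ j)) =
          Q.card * ((1 - levelWeight r M) / r) := by
      intro Q hQ
      have hQs : ∀ j ∈ Q, s j = M + 1 := fun j hj => (Finset.mem_filter.1 (hQ hj)).2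
      have hQT : T ∩ Q = Q :=
        Finset.inter_eq_right.2 (hQ.trans (Finset.filter_subset _ _))
      refine ⟨fun j => if j ∈ Q then M else s j, fun j => ?_, fun j => rfl, ?_, ?_⟩
      · by_cases hj : j ∈ Q
        · simp [hj, hQs j hj]
        · simp [hj]
      · have : ∀ j ∈ T, s j = (if j ∈ Q then M else s j) + if j ∈ Q then 1 else 0 := by
          intro j _
          by_cases hj : j ∈ Q
          · simp [hj, hQs j hj]
          · simp [hj]
        rw [Finset.sum_congr rfl this, Finset.sum_add_distrib]
        simp [Finset.sum_ite_mem, hQT]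
      · have : ∀ j ∈ T, levelWeight r (s j) - levelWeight r (if j ∈ Q then M else s j) =
            if j ∈ Q then (1 - levelWeight r M) / r else 0 := by
          intro j _
          by_cases hj : j ∈ Q
          · simp [hj, hQs j hj, levelWeight_succ]
          · simp [hj]
        rw [Finset.sum_congr rfl this, Finset.sum_ite_mem, hQT]
        simp
    by_cases hcase : n ≤ N.card
    · obtain ⟨Q, hQN, hQ, hle⟩ := exists_subset_card_mul_sum_le c N n hcase
      obtain ⟨s₁, hs₁, hval, hsum, hcost⟩ := key Q hQN
      refine ⟨s₁, hs₁, by omega, ?_⟩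
      rw [hcost, hQ]
      have hNr : (N.card : ℝ) ≤ r := by
        exact_mod_cast (Finset.card_filter_le _ _).trans hT
      have hQ0 : 0 ≤ ∑ j ∈ Q, c j := Finset.sum_nonneg fun j _ => hc j
      have hshare : (n : ℝ) / r * ∑ j ∈ N, c j ≤ ∑ j ∈ Q, c j := by
        rw [div_mul_eq_mul_div, div_le_iff₀ hr0]
        nlinarith
      have hbound : ∑ j ∈ T, c j * levelWeight r (s₁ j) ≤
          levelWeight r M * ∑ j ∈ T, c j +
            (1 - levelWeight r M) / r * (∑ j ∈ N, c j - ∑ j ∈ Q, c j) := by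
        have hQT : T ∩ Q = Q :=
          Finset.inter_eq_right.2 (hQN.trans (Finset.filter_subset _ _))
        have hpt : ∀ j ∈ T, c j * levelWeight r (s₁ j) ≤ levelWeight r M * c j +
            (1 - levelWeight r M) / r *
              ((if s j = M + 1 then c j else 0) - if j ∈ Q then c j else 0) := by
          intro j hj
          rw [hval]
          by_cases hjQ : j ∈ Q
          · have : s j = M + 1 := (Finset.mem_filter.1 (hQN hjQ)).2
            simp [hjQ, this, mul_comm]
          · by_cases hjs : s j = M + 1
            · simp only [hjQ, hjs, if_true, if_false, levelWeight_succ]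
              apply le_of_eq; ring
            · simp only [hjQ, hjs, if_false]
              have : levelWeight r (s j) ≤ levelWeight r M :=
                levelWeight_mono hr (by have := hs j hj; omega)
              nlinarith [hc j]
        refine (Finset.sum_le_sum hpt).trans (le_of_eq ?_)
        rw [Finset.sum_add_distrib, ← Finset.mul_sum, ← Finset.mul_sum,
          Finset.sum_sub_distrib, Finset.sum_ite_mem, hQT, hN, Finset.sum_filter]
      have hNT : ∑ j ∈ N, c j ≤ ∑ j ∈ T, c j :=
        Finset.sum_le_sum_of_subset_of_nonneg (Finset.filter_subset _ _) fun j _ _ => hc j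
      have hdiff : ∑ j ∈ N, c j - ∑ j ∈ Q, c j ≤ (1 - (n : ℝ) / r) * a := by
        have : (1 - (n : ℝ) / r) * ∑ j ∈ N, c j ≤ (1 - (n : ℝ) / r) * a :=
          mul_le_mul_of_nonneg_left (hNT.trans hca) (by linarith)
        linarith
      have hq : 0 ≤ (1 - levelWeight r M) / r := div_nonneg hM1 hr0.le
      have e1 := mul_le_mul_of_nonneg_left hdiff hq
      have e2 := mul_le_mul_of_nonneg_left hca hM0
      rw [levelWeight_succ]
      have e3 : a * (1 - (1 - (n : ℝ) / r) *
          (1 - (levelWeight r M + (1 - levelWeight r M) / r))) =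
          a * (n * ((1 - levelWeight r M) / r)) + levelWeight r M * a +
            (1 - levelWeight r M) / r * ((1 - (n : ℝ) / r) * a) := by ring
      linarith
    · obtain ⟨s₁, hs₁, hval, hsum, hcost⟩ := key N subset_rfl
      obtain ⟨s', hs', hsum', hcost'⟩ := ih s₁ (n - N.card) (by
        intro j hj
        rw [hval]
        by_cases hjN : j ∈ N
        · simp [hjN]
        · have h1 := hs j hj
          have h2 : s j ≠ M + 1 := fun h => hjN (Finset.mem_filter.2 ⟨hj, h⟩)
          simp only [hjN, if_false]; omega) (by omega) (by omega)
      refine ⟨s', hs'.trans hs₁, by omega, ?_⟩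
      have hsplit : ∑ j ∈ T, (levelWeight r (s j) - levelWeight r (s' j)) =
          N.card * ((1 - levelWeight r M) / r) +
            ∑ j ∈ T, (levelWeight r (s₁ j) - levelWeight r (s' j)) := by
        rw [← hcost, ← Finset.sum_add_distrib]
        exact Finset.sum_congr rfl fun j _ => by ring
      rw [Nat.cast_sub (by omega)] at hcost'
      rw [hsplit]
      have hmono : a * ((1 - (n : ℝ) / r) * (1 - levelWeight r (M + 1))) ≤
          a * ((1 - (n : ℝ) / r) * (1 - levelWeight r M)) := by
        have := levelWeight_mono hr (Nat.le_succ M)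
        exact mul_le_mul_of_nonneg_left
          (mul_le_mul_of_nonneg_left (by linarith) (by linarith)) ha
      have e : a * (N.card * ((1 - levelWeight r M) / r)) +
          a * (1 - (1 - ((n : ℝ) - N.card) / r) * (1 - levelWeight r M)) =
          a - a * ((1 - (n : ℝ) / r) * (1 - levelWeight r M)) := by ring
      linarith

/-- One greedy step of gain `a`: if the residuals `o` are at most `a` and the step removes `c`,
supported on at most `r` indices and of total at most `a`, then `r` level units can be removed so
that the weighted residual drops by at most `a`. -/
lemma exists_levels_after_step {ι : Type*} [Fintype ι] [DecidableEq ι] {r : ℕ} (hr : 1 ≤ r)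
    (T : Finset ι) (hT : T.card ≤ r) (o c : ι → ℝ) (a : ℝ) (hc : ∀ j, 0 ≤ c j)
    (hcT : ∀ j ∉ T, c j = 0) (hca : ∑ j, c j ≤ a) (hoa : ∀ j, o j ≤ a)
    (s : ι → ℕ) (hs : r ≤ ∑ j, s j) :
    ∃ s' : ι → ℕ, ∑ j, s' j + r = ∑ j, s j ∧
      ∑ j, levelWeight r (s j) * o j ≤ a + ∑ j, levelWeight r (s' j) * (o j - c j) := by
  have ha : 0 ≤ a := (Finset.sum_nonneg fun j _ => hc j).trans hca
  have hr0 : (0 : ℝ) < r := by exact_mod_cast hr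
  have hsupp : ∀ v : ι → ℕ, ∑ j, c j * levelWeight r (v j) =
      ∑ j ∈ T, c j * levelWeight r (v j) := fun v =>
    (Finset.sum_subset (Finset.subset_univ T) fun j _ hj => by rw [hcT j hj, zero_mul]).symm
  suffices h : ∃ s' ≤ s, ∑ j, s' j + r = ∑ j, s j ∧
      a * ∑ j, (levelWeight r (s j) - levelWeight r (s' j)) +
        ∑ j, c j * levelWeight r (s' j) ≤ a by
    obtain ⟨s', hle, hsum, hcost⟩ := h
    refine ⟨s', hsum, ?_⟩
    rw [Finset.mul_sum] at hcost
    have hpt : ∑ j, levelWeight r (s j) * o j ≤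
        ∑ j, (a * (levelWeight r (s j) - levelWeight r (s' j)) + c j * levelWeight r (s' j) +
          levelWeight r (s' j) * (o j - c j)) := by
      refine Finset.sum_le_sum fun j _ => ?_
      have := mul_le_mul_of_nonneg_right (hoa j)
        (sub_nonneg.2 (levelWeight_mono hr (hle j)))
      linarith
    rw [Finset.sum_add_distrib, Finset.sum_add_distrib] at hpt
    linarith
  by_cases hcase : r ≤ ∑ j ∈ T, s j
  · have hcaT : ∑ j ∈ T, c j ≤ a :=
      (Finset.sum_le_sum_of_subset_of_nonneg (Finset.subset_univ T) fun j _ _ => hc j).trans hca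
    obtain ⟨s₁, hle, hsum, hcost⟩ := exists_lower_levels hr T hT c hc a hcaT (T.sup s) s r
      (fun j hj => Finset.le_sup hj) le_rfl hcase
    obtain ⟨s', hin, hout⟩ : ∃ s' : ι → ℕ, (∀ j ∈ T, s' j = s₁ j) ∧ ∀ j ∉ T, s' j = s j :=
      ⟨fun j => if j ∈ T then s₁ j else s j, fun j hj => if_pos hj, fun j hj => if_neg hj⟩
    refine ⟨s', fun j => ?_, ?_, ?_⟩
    · by_cases hj : j ∈ T
      · rw [hin j hj]; exact hle j
      · rw [hout j hj]
    · rw [← Finset.sum_add_sum_compl T s, ← hsum, ← Finset.sum_add_sum_compl T,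
        Finset.sum_congr rfl hin,
        Finset.sum_congr (s₁ := Tᶜ) rfl fun j hj => hout j (Finset.mem_compl.1 hj)]
      ring
    · have h1 : ∑ j, (levelWeight r (s j) - levelWeight r (s' j)) =
          ∑ j ∈ T, (levelWeight r (s j) - levelWeight r (s₁ j)) := by
        rw [← Finset.sum_subset (Finset.subset_univ T) fun j _ hj => by
          rw [hout j hj, sub_self]]
        exact Finset.sum_congr rfl fun j hj => by rw [hin j hj]
      have h2 : ∑ j ∈ T, c j * levelWeight r (s' j) = ∑ j ∈ T, c j * levelWeight r (s₁ j) :=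
        Finset.sum_congr rfl fun j hj => by rw [hin j hj]
      rw [hsupp, h1, h2]
      rw [div_self hr0.ne'] at hcost
      linarith
  · have hsplit := Finset.sum_add_sum_compl T s
    obtain ⟨v, hv, hvsum⟩ := exists_le_sum_eq Tᶜ s (∑ j, s j - r) (by omega)
    set s' : ι → ℕ := fun j => if j ∈ T then 0 else v j with hs'
    have hle : s' ≤ s := fun j => by
      by_cases hj : j ∈ T
      · simp [hs', hj]
      · simpa [hs', hj] using hv j
    have hsum : ∑ j, s' j + r = ∑ j, s j := by
      rw [← Finset.sum_add_sum_compl T s',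
        Finset.sum_eq_zero (s := T) fun j hj => by simp [hs', hj],
        Finset.sum_congr (s₁ := Tᶜ) (g := fun j => v j) rfl fun j hj => if_neg (Finset.mem_compl.1 hj)]
      omega
    refine ⟨s', hle, hsum, ?_⟩
    have hzero : ∑ j, c j * levelWeight r (s' j) = 0 := by
      rw [hsupp]
      exact Finset.sum_eq_zero fun j hj => by simp [hs', hj, levelWeight_zero]
    have hone : ∑ j, (levelWeight r (s j) - levelWeight r (s' j)) ≤ 1 := by
      refine (Finset.sum_le_sum fun j _ => levelWeight_sub_le hr (hle j)).trans ?_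
      rw [← Finset.sum_div, Finset.sum_sub_distrib, div_le_one hr0]
      have : (∑ j, (s' j : ℝ)) + r = ∑ j, (s j : ℝ) := by exact_mod_cast hsum
      linarith
    rw [hzero, add_zero]
    exact mul_le_of_le_one_right ha hone


/-- the greedy algorithm is a `1 − (1 − 1/r)^r` approximation for
weighted Maximum Coverage when every set in `𝓡` has cardinality at most `r`. -/
theorem statement6 {α : Type*} [DecidableEq α] (U : Finset α)
    (𝓡 : Finset (Finset α)) (h𝓡 : 𝓡.Nonempty) (hsub : ∀ R ∈ 𝓡, R ⊆ U)
    (k : ℕ) (hk : 1 ≤ k) (w : α → ℝ) (hw : ∀ x, 0 ≤ w x)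
    (r : ℕ) (hr1 : 1 ≤ r) (hrk : r ≤ k)
    (hcard : ∀ R ∈ 𝓡, R.card ≤ r)
    (g : Fin k → Finset α) (hgmem : ∀ i, g i ∈ 𝓡)
    (hgreedy : ∀ i, ∀ T ∈ 𝓡,
      ∑ x ∈ T \ (Finset.Iio i).sup g, w x ≤ ∑ x ∈ g i \ (Finset.Iio i).sup g, w x) :
    ∀ S : Fin k → Finset α, (∀ i, S i ∈ 𝓡) →
      ∑ x ∈ Finset.univ.sup g, w x ≥
        (1 - (1 - 1 / (r : ℝ)) ^ r) * ∑ x ∈ Finset.univ.sup S, w x := by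
  intro S hS
  set O := Finset.univ.sup S with hO
  have hsel : ∀ x, ∃ j, x ∈ O → x ∈ S j := by
    intro x
    by_cases hx : x ∈ O
    · obtain ⟨j, _, hj⟩ := Finset.mem_sup.1 hx
      exact ⟨j, fun _ => hj⟩
    · exact ⟨⟨0, hk⟩, fun h => absurd h hx⟩
  choose f hf using hsel
  -- the optimal sets made disjoint
  set P : Fin k → Finset α := fun j => O.filter fun x => f x = j with hP
  set C : ℕ → Finset α := fun t => (Finset.univ.filter fun i : Fin k => i.val < t).sup g with hC
  have hPS : ∀ j, P j ⊆ S j := fun j x hx => by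
    obtain ⟨hxO, rfl⟩ := Finset.mem_filter.1 hx
    exact hf x hxO
  have invariant : ∀ t ≤ k, ∃ s : Fin k → ℕ, ∑ j, s j + r * t = r * k ∧
      levelWeight r r * ∑ x ∈ O, w x ≤
        ∑ x ∈ C t, w x + ∑ j, levelWeight r (s j) * ∑ x ∈ P j \ C t, w x := by
    intro t
    induction t with
    | zero =>
      intro _
      refine ⟨fun _ => r, by simp [mul_comm], ?_⟩
      have hfib : ∑ j, ∑ x ∈ P j, w x = ∑ x ∈ O, w x := Finset.sum_fiberwise O f w
      simp [hC, ← Finset.mul_sum, hfib]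
    | succ t ih =>
      intro ht
      obtain ⟨s, hsum, hle⟩ := ih (by omega)
      set i : Fin k := ⟨t, ht⟩ with hi
      have hIio : (Finset.Iio i).sup g = C t := by
        simp only [hC]
        congr 1
        ext j
        simp [hi, Fin.lt_def]
      have hCsucc : C (t + 1) = C t ∪ g i := by
        have : (Finset.univ.filter fun j : Fin k => j.val < t + 1) =
            insert i (Finset.univ.filter fun j : Fin k => j.val < t) := by
          ext j
          simp only [Finset.mem_filter, Finset.mem_univ, true_and, Finset.mem_insert, hi,
            Fin.ext_iff]
          omega
        simp only [hC, this, Finset.sup_insert]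
        exact Finset.union_comm _ _
      have hgain := hgreedy i
      rw [hIio] at hgain
      have hres : ∀ j, ∑ x ∈ P j \ C (t + 1), w x =
          ∑ x ∈ P j \ C t, w x - ∑ x ∈ (P j \ C t) ∩ g i, w x := by
        intro j
        rw [hCsucc, ← Finset.sup_eq_union, ← sdiff_sdiff_left,
          ← Finset.sum_inter_add_sum_sdiff (P j \ C t) (g i) w]
        ring
      obtain ⟨s', hsum', hle'⟩ := exists_levels_after_step hr1 ((g i).image f)
        (Finset.card_image_le.trans (hcard _ (hgmem i)))
        (fun j => ∑ x ∈ P j \ C t, w x) (fun j => ∑ x ∈ (P j \ C t) ∩ g i, w x)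
        (∑ x ∈ g i \ C t, w x) (fun j => Finset.sum_nonneg fun x _ => hw x)
        (by
          intro j hj
          refine Finset.sum_eq_zero fun x hx => absurd ?_ hj
          simp only [hP, Finset.mem_inter, Finset.mem_sdiff, Finset.mem_filter] at hx
          exact Finset.mem_image.2 ⟨x, hx.2, hx.1.1.2⟩)
        (by
          rw [← Finset.sum_fiberwise (g i \ C t) f w]
          refine Finset.sum_le_sum fun j _ =>
            Finset.sum_le_sum_of_subset_of_nonneg (fun x hx => ?_) fun x _ _ => hw x
          simp only [hP, Finset.mem_inter, Finset.mem_sdiff, Finset.mem_filter] at hx ⊢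
          tauto)
        (fun j => (Finset.sum_le_sum_of_subset_of_nonneg
          (Finset.sdiff_subset_sdiff (hPS j) subset_rfl) fun x _ _ => hw x).trans
            (hgain _ (hS j)))
        s (by
          have : r * (t + 1) ≤ r * k := Nat.mul_le_mul_left r ht
          rw [Nat.mul_succ] at this
          omega)
      refine ⟨s', by rw [Nat.mul_succ]; omega, ?_⟩
      have hcov : ∑ x ∈ C (t + 1), w x = ∑ x ∈ C t, w x + ∑ x ∈ g i \ C t, w x := by
        rw [hCsucc, ← Finset.union_sdiff_self_eq_union,
          Finset.sum_union Finset.disjoint_sdiff]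
      simp only [hres, hcov]
      linarith
  obtain ⟨s, hsum, hle⟩ := invariant k le_rfl
  have hs0 : ∀ j, s j = 0 := fun j => by
    have h0 : ∑ j, s j = 0 := by omega
    exact Finset.sum_eq_zero_iff.1 h0 j (Finset.mem_univ j)
  have hCk : C k = Finset.univ.sup g := by simp [hC]
  simpa [hs0, levelWeight_zero, hCk, levelWeight] using hle
end

section
/- Let r ≥ 1 be an integer, let OPT ≥ 0 be a real number, and let x₁, …, x_r be nonnegative reals satisfying, for every 1 ≤ l ≤ r, the inequality x_l ≥ (OPT − Σ_{i=1}^{l−1} x_i) / r. Then Σ_{l=1}^{r} x_l ≥ (1 − (1 − 1/r)^r) · OPT. -/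
/-- If each `x l` is at least a `c`-fraction of what the earlier terms leave of `b`, then after
`n` terms at most `(1 - c) ^ n * b` is left. -/
theorem sub_sum_le_one_sub_pow_mul {c b : ℝ} (hc : c ≤ 1) (n : ℕ) (x : Fin n → ℝ)
    (h : ∀ l, c * (b - ∑ i ∈ Finset.Iio l, x i) ≤ x l) :
    b - ∑ l, x l ≤ (1 - c) ^ n * b := by
  induction n with
  | zero => simp
  | succ n ih =>
    have hinit : b - ∑ l : Fin n, x l.castSucc ≤ (1 - c) ^ n * b :=
      ih (fun l => x l.castSucc) fun l => by
        simpa [← Fin.map_castSuccEmb_Iio] using h l.castSucc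
    have hlast : c * (b - ∑ l : Fin n, x l.castSucc) ≤ x (Fin.last n) := by
      simpa [Fin.Iio_last_eq_map] using h (Fin.last n)
    rw [Fin.sum_univ_castSucc, pow_succ']
    linarith [mul_le_mul_of_nonneg_left hinit (sub_nonneg.2 hc)]

/-- if nonnegative reals `x₁,…,x_r` satisfy
`x_l ≥ (OPT − Σ_{i<l} x_i)/r` for each `l`, then
`Σ x_l ≥ (1 − (1 − 1/r)^r)·OPT`. -/
theorem statement7 (r : ℕ) (hr : 1 ≤ r) (OPT : ℝ) (hOPT : 0 ≤ OPT)
    (x : Fin r → ℝ) (hx : ∀ l, 0 ≤ x l)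
    (hrec : ∀ l : Fin r, x l ≥ (OPT - ∑ i ∈ Finset.Iio l, x i) / r) :
    ∑ l, x l ≥ (1 - (1 - 1 / (r : ℝ)) ^ r) * OPT := by
  have hc : 1 / (r : ℝ) ≤ 1 := by
    rw [one_div]
    exact inv_le_one_of_one_le₀ (by exact_mod_cast hr)
  have hgap := sub_sum_le_one_sub_pow_mul (b := OPT) hc r x fun l => by
    rw [one_div_mul_eq_div]
    exact hrec l
  linarith
end

section
/- Let r, l, q, z be integers with 1 ≤ l ≤ r and 0 ≤ z ≤ q ≤ r. Then r · Σ_{m=0}^{z} C(l−1, m) · C(r−l, q−m−1) ≥ q · Σ_{m=0}^{z} C(l−1, m) · C(r−l+1, q−m), where C(a, b) denotes the binomial coefficient, with the convention that C(a, b) = 0 whenever b < 0 or b > a. -/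
/-- Binomial coefficient with an integer lower argument, taken to be `0` when
the lower argument is negative (and, via `Nat.choose`, when it exceeds the
upper argument). -/
def chooseZ (a : ℕ) (b : ℤ) : ℕ := if 0 ≤ b then a.choose b.toNat else 0

theorem chooseZ_of_neg (a : ℕ) {k : ℤ} (hk : k < 0) : chooseZ a k = 0 :=
  if_neg (not_le.mpr hk)

theorem chooseZ_natCast (a k : ℕ) : chooseZ a (k : ℤ) = a.choose k := by
  simp [chooseZ]

theorem chooseZ_succ (b : ℕ) (k : ℤ) :
    chooseZ (b + 1) k = chooseZ b k + chooseZ b (k - 1) := by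
  rcases lt_or_ge k 0 with hk | hk
  · simp [chooseZ_of_neg _ hk, chooseZ_of_neg b (show k - 1 < 0 by omega)]
  · lift k to ℕ using hk
    cases k with
    | zero => simp [chooseZ]
    | succ n =>
      rw [show ((n + 1 : ℕ) : ℤ) - 1 = (n : ℤ) by push_cast; ring]
      simp only [chooseZ_natCast]
      rw [Nat.choose_succ_succ', add_comm]

theorem mul_chooseZ_succ (b : ℕ) (k : ℤ) :
    k * chooseZ (b + 1) k = (b + 1) * chooseZ b (k - 1) := by
  rcases lt_or_ge k 0 with hk | hk
  · simp [chooseZ_of_neg _ hk, chooseZ_of_neg b (show k - 1 < 0 by omega)]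
  · lift k to ℕ using hk
    cases k with
    | zero => simp [chooseZ]
    | succ n =>
      rw [show ((n + 1 : ℕ) : ℤ) - 1 = (n : ℤ) by push_cast; ring]
      simp only [chooseZ_natCast]
      have h := Nat.add_one_mul_choose_eq b n
      zify at h
      push_cast
      linarith

/-- The difference of the `m`-th summands on the two sides telescopes. -/
theorem choose_mul_chooseZ_telescope (a b m : ℕ) (q : ℤ) :
    (a + b + 1) * (a.choose m * chooseZ b (q - m - 1) : ℤ) + m * a.choose m * chooseZ b (q - m)
      = q * (a.choose m * chooseZ (b + 1) (q - m))
        + (m + 1) * a.choose (m + 1) * chooseZ b (q - m - 1) := by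
  have hpascal := chooseZ_succ b (q - m)
  have habsorb := mul_chooseZ_succ b (q - m)
  have hchoose : ((m : ℤ) + 1) * a.choose (m + 1) = (a - m) * a.choose m := by
    have h₁ := Nat.add_one_mul_choose_eq a m
    have h₂ := Nat.choose_succ_succ' a m
    zify at h₁ h₂
    rw [h₂] at h₁
    linear_combination -h₁
  zify at hpascal
  linear_combination (-(a.choose m : ℤ)) * habsorb - m * a.choose m * hpascal
    - (chooseZ b (q - m - 1) : ℤ) * hchoose

theorem sum_choose_mul_chooseZ (a b z : ℕ) (q : ℤ) :
    (a + b + 1) * ∑ m ∈ Finset.range (z + 1), (a.choose m * chooseZ b (q - m - 1) : ℤ)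
      = q * ∑ m ∈ Finset.range (z + 1), (a.choose m * chooseZ (b + 1) (q - m) : ℤ)
        + (z + 1) * a.choose (z + 1) * chooseZ b (q - z - 1) := by
  induction z with
  | zero => simpa using choose_mul_chooseZ_telescope a b 0 q
  | succ z ih =>
    have h := choose_mul_chooseZ_telescope a b (z + 1) q
    rw [Finset.sum_range_succ, Finset.sum_range_succ _ (z + 1), mul_add, mul_add, ih]
    rw [show q - ((z + 1 : ℕ) : ℤ) = q - z - 1 by push_cast; ring] at h ⊢
    push_cast at h ⊢
    linear_combination h

/-- for `1 ≤ l ≤ r` and `0 ≤ z ≤ q ≤ r`,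
`r · Σ_{m=0}^{z} C(l−1, m)·C(r−l, q−m−1) ≥ q · Σ_{m=0}^{z} C(l−1, m)·C(r−l+1, q−m)`. -/
theorem statement8 (r l q z : ℕ) (hl1 : 1 ≤ l) (hlr : l ≤ r) (hzq : z ≤ q) (hqr : q ≤ r) :
    q * ∑ m ∈ Finset.range (z + 1), (l - 1).choose m * chooseZ (r - l + 1) ((q : ℤ) - m)
      ≤ r * ∑ m ∈ Finset.range (z + 1), (l - 1).choose m * chooseZ (r - l) ((q : ℤ) - m - 1) := by
  obtain ⟨a, rfl⟩ := Nat.exists_eq_add_of_le' hl1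
  obtain ⟨b, rfl⟩ := Nat.exists_eq_add_of_le hlr
  have h := sum_choose_mul_chooseZ a b z q
  have hnonneg : (0 : ℤ) ≤ (z + 1) * a.choose (z + 1) * chooseZ b (q - z - 1) := by positivity
  simp only [Nat.add_sub_cancel, Nat.add_sub_cancel_left]
  zify
  linarith
end

section
/- For every ε > 0 there exist a positive integer k, a finite bipartite graph G with vertex bipartition U ∪ W and edge set E, and a sequence of k vertices w₁, …, w_k forming a valid execution of the greedy algorithm for Maximum Vertex Coverage (i.e., each w_i covers at least as many edges not covered by w₁,…,w_{i−1} as any other vertex of G does), such that: U is a vertex cover of G of size k (so k vertices can cover all of E), yet the number of edges covered by w₁, …, w_k is less than (1 − 1/e + ε)·|E|. -/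
/-- The set of edges of `G` covered by (incident to) a set `C` of vertices. -/
def edgesCov {V : Type*} (G : SimpleGraph V) (C : Set V) : Set (Sym2 V) :=
  {e | e ∈ G.edgeSet ∧ ∃ v ∈ C, v ∈ e}

/-- The number of edges left uncovered after `i` steps of a greedy execution that starts with `k ^ 2`
edges and covers a `1 / k` fraction, rounded up, of the uncovered edges in each step. -/
def uncovered (k : ℕ) : ℕ → ℕ
  | 0 => k ^ 2
  | i + 1 => uncovered k i - (uncovered k i + k - 1) / k

lemma uncovered_succ (k i : ℕ) :
    uncovered k (i + 1) = uncovered k i - (uncovered k i + k - 1) / k := rfl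

lemma uncovered_antitone (k : ℕ) : Antitone (uncovered k) :=
  antitone_nat_of_succ_le fun i => by rw [uncovered_succ]; exact Nat.sub_le _ _

lemma uncovered_le (k i : ℕ) : uncovered k i ≤ k ^ 2 :=
  uncovered_antitone k (Nat.zero_le i)

lemma ceilDiv_le_self {k : ℕ} (hk : 1 ≤ k) (a : ℕ) : (a + k - 1) / k ≤ a := by
  rw [Nat.div_le_iff_le_mul_add_pred hk]
  have := Nat.le_mul_of_pos_left a hk
  omega

lemma div_lt_ceilDiv {k : ℕ} (hk : 1 ≤ k) {a p : ℕ} (hp : p < a) :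
    p / k < (a + k - 1) / k := by
  have h : (p + k) / k ≤ (a + k - 1) / k := Nat.div_le_div_right (by omega)
  rw [Nat.add_div_right p hk] at h
  omega

lemma uncovered_succ_add {k : ℕ} (hk : 1 ≤ k) (i : ℕ) :
    uncovered k (i + 1) + (uncovered k i + k - 1) / k = uncovered k i := by
  rw [uncovered_succ]
  exact Nat.sub_add_cancel (ceilDiv_le_self hk _)

lemma uncovered_eq_zero_or_add_le {k : ℕ} (hk : 1 ≤ k) (i : ℕ) :
    uncovered k i = 0 ∨ uncovered k i + i ≤ k ^ 2 := by
  induction i with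
  | zero => right; simp [uncovered]
  | succ i ih =>
    have h := uncovered_succ_add hk i
    rcases Nat.eq_zero_or_pos (uncovered k i) with h0 | h0
    · exact Or.inl (Nat.eq_zero_of_add_eq_zero_right (h.trans h0))
    · have hpos := (Nat.zero_le _).trans_lt (div_lt_ceilDiv hk h0)
      generalize (uncovered k i + k - 1) / k = c at h hpos
      omega

lemma uncovered_sq {k : ℕ} (hk : 1 ≤ k) : uncovered k (k ^ 2) = 0 := by
  rcases uncovered_eq_zero_or_add_le hk (k ^ 2) with h | h <;> omega

lemma ceilDiv_uncovered_le {k : ℕ} (hk : 1 ≤ k) (i : ℕ) :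
    (uncovered k i + k - 1) / k ≤ k := by
  have h := uncovered_le k i
  rw [Nat.div_le_iff_le_mul_add_pred hk]
  nlinarith [Nat.sub_add_cancel hk, Nat.sub_add_cancel (show 1 ≤ uncovered k i + k by omega)]

lemma le_uncovered {k : ℕ} (hk : 1 ≤ k) (i : ℕ) :
    (k : ℝ) ^ 2 * (1 - 1 / k) ^ i - i ≤ uncovered k i := by
  have hk0 : (0 : ℝ) < k := by exact_mod_cast hk
  have hk1 : (1 : ℝ) / k ≤ 1 := by
    rw [div_le_one hk0]; exact_mod_cast hk
  induction i with
  | zero => simp [uncovered]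
  | succ i ih =>
    have h : (uncovered k (i + 1) : ℝ) + ((uncovered k i + k - 1) / k : ℕ) = uncovered k i := by
      exact_mod_cast uncovered_succ_add hk i
    have hc : (((uncovered k i + k - 1) / k : ℕ) : ℝ) ≤ uncovered k i * (1 / k) + 1 := by
      refine Nat.cast_div_le.trans ?_
      rw [div_le_iff₀ hk0]
      have : ((uncovered k i + k - 1 : ℕ) : ℝ) ≤ uncovered k i + k := by
        exact_mod_cast Nat.sub_le _ _
      field_simp
      exact this
    have hm := mul_le_mul_of_nonneg_right ih (sub_nonneg.2 hk1)
    have hi : (0 : ℝ) ≤ i * (1 / k) := by positivity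
    rw [pow_succ _ i]
    push_cast
    linarith

/-- Edges are numbered so that the `p`-th one is covered at step `i` exactly when
`uncovered k (i + 1) ≤ p < uncovered k i`. -/
lemma exists_coveringStep {k : ℕ} (hk : 1 ≤ k) :
    ∃ t : ℕ → Fin (k ^ 2), ∀ p < k ^ 2, ∀ i, (t p : ℕ) < i ↔ uncovered k i ≤ p := by
  have hex (p : ℕ) : ∃ i, uncovered k (i + 1) ≤ p :=
    ⟨k ^ 2, ((uncovered_antitone k (Nat.le_succ _)).trans (uncovered_sq hk).le).trans p.zero_le⟩
  have hpos : 0 < k ^ 2 := by positivity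
  classical
  refine ⟨fun p => ⟨Nat.find (hex p), ?_⟩, fun p hp i => ?_⟩
  · rw [Nat.find_lt_iff]
    refine ⟨k ^ 2 - 1, by omega, ?_⟩
    rw [Nat.sub_add_cancel hpos, uncovered_sq hk]
    exact p.zero_le
  · simp only [Nat.find_lt_iff]
    constructor
    · rintro ⟨j, hj, h⟩
      exact (uncovered_antitone k hj).trans h
    · intro h
      cases i with
      | zero => simp only [uncovered] at h; omega
      | succ i => exact ⟨i, Nat.lt_succ_self i, h⟩

lemma card_filter_mod_eq_le {k : ℕ} (hk : 1 ≤ k) (a u : ℕ) :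
    ((Finset.range a).filter (· % k = u)).card ≤ (a + k - 1) / k := by
  rw [← Finset.card_range ((a + k - 1) / k)]
  refine Finset.card_le_card_of_injOn (· / k) (fun p hp => ?_) (fun p hp q hq h => ?_)
  · simp only [Finset.coe_filter, Finset.mem_range, Set.mem_ofPred_eq] at hp
    simpa using div_lt_ceilDiv hk hp.1
  · simp only [Finset.coe_filter, Finset.mem_range, Set.mem_ofPred_eq] at hp hq h
    rw [← Nat.div_add_mod p k, ← Nat.div_add_mod q k, h, hp.2, hq.2]

lemma exists_lt_one_sub_inv_pow {ε : ℝ} (hε : 0 < ε) :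
    ∃ k : ℕ, 1 ≤ k ∧ 1 / Real.exp 1 - ε < (1 - 1 / (k : ℝ)) ^ k - 1 / k := by
  have h1 := Real.tendsto_one_add_div_pow_exp (-1)
  have h2 := h1.sub tendsto_one_div_atTop_nhds_zero_nat
  have h3 : 1 / Real.exp 1 - ε < Real.exp (-1) - 0 := by
    rw [Real.exp_neg, one_div]; linarith
  obtain ⟨k, hk, hk1⟩ :=
    ((h2.eventually (lt_mem_nhds h3)).and (Filter.eventually_ge_atTop 1)).exists
  refine ⟨k, hk1, ?_⟩
  rwa [neg_div, ← sub_eq_add_neg] at hk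

/-- for every `ε > 0` there is a finite bipartite graph with a vertex
cover `U` of size `k`, and a valid `k`-step greedy execution `w₁,…,w_k` for Maximum
Vertex Coverage covering fewer than `(1 − 1/e + ε)·|E|` edges. -/
theorem statement9 (ε : ℝ) (hε : 0 < ε) :
    ∃ (V : Type) (_ : Fintype V) (G : SimpleGraph V) (Us Ws : Set V) (k : ℕ)
      (w : Fin k → V),
      1 ≤ k ∧
      Disjoint Us Ws ∧ Us ∪ Ws = Set.univ ∧
      (∀ u v, G.Adj u v → (u ∈ Us ∧ v ∈ Ws) ∨ (u ∈ Ws ∧ v ∈ Us)) ∧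
      Us.ncard = k ∧
      (∀ u v, G.Adj u v → u ∈ Us ∨ v ∈ Us) ∧
      (∀ i : Fin k, ∀ v : V,
        (edgesCov G ((w '' {j | j < i}) ∪ {v})).ncard ≤
          (edgesCov G ((w '' {j | j < i}) ∪ {w i})).ncard) ∧
      ((edgesCov G (Set.range w)).ncard : ℝ) <
        (1 - 1 / Real.exp 1 + ε) * (G.edgeSet.ncard : ℝ) := by
  classical
  obtain ⟨k, hk, hlim⟩ := exists_lt_one_sub_inv_pow hε
  obtain ⟨t, ht⟩ := exists_coveringStep hk
  have hksq : k ≤ k ^ 2 := Nat.le_self_pow two_ne_zero k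
  let e : ℕ → Sym2 (Fin k ⊕ Fin (k ^ 2)) :=
    fun p => s(Sum.inl ⟨p % k, Nat.mod_lt p hk⟩, Sum.inr (t p))
  have ht_eq {p : ℕ} (hp : p < k ^ 2) :
      uncovered k (t p + 1) ≤ p ∧ p < uncovered k (t p) :=
    ⟨(ht p hp _).1 (Nat.lt_succ_self _), not_le.1 fun h => lt_irrefl _ ((ht p hp _).2 h)⟩
  have he_inj : Set.InjOn e (Finset.range (k ^ 2)) := by
    intro p hp q hq hpq
    simp only [Finset.coe_range, Set.mem_Iio] at hp hq
    simp only [e, Sym2.eq_iff, Sum.inl.injEq, Sum.inr.injEq, Fin.mk.injEq, reduceCtorEq,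
      and_self, or_false] at hpq
    obtain ⟨hmod, htpq⟩ := hpq
    have hp' := ht_eq hp
    have hq' := ht_eq hq
    rw [← htpq] at hq'
    have hstep := uncovered_succ_add hk (t p)
    have hle := ceilDiv_uncovered_le hk (t p)
    by_contra hne
    rcases Nat.lt_or_gt_of_ne hne with hlt | hlt
    · have := Nat.le_of_dvd (by omega) ((Nat.modEq_iff_dvd' hlt.le).1 hmod)
      omega
    · have := Nat.le_of_dvd (by omega) ((Nat.modEq_iff_dvd' hlt.le).1 hmod.symm)
      omega
  let G := SimpleGraph.fromEdgeSet (e '' (Finset.range (k ^ 2)))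
  have hE : G.edgeSet = e '' (Finset.range (k ^ 2)) := by
    rw [SimpleGraph.edgeSet_fromEdgeSet, sdiff_eq_left, Set.disjoint_left]
    rintro _ ⟨p, -, rfl⟩
    simp [e]
  have hadj (x y) (h : G.Adj x y) :
      (x ∈ Set.range Sum.inl ∧ y ∈ Set.range Sum.inr) ∨
        (x ∈ Set.range Sum.inr ∧ y ∈ Set.range Sum.inl) := by
    rw [← SimpleGraph.mem_edgeSet, hE] at h
    obtain ⟨p, -, hp⟩ := h
    simp only [e, Sym2.eq_iff] at hp
    rcases hp with ⟨rfl, rfl⟩ | ⟨rfl, rfl⟩ <;> simp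
  have hcov (C) (P : ℕ → Prop) [DecidablePred P]
      (hP : ∀ p < k ^ 2, (∃ v ∈ C, v ∈ e p) ↔ P p) :
      (edgesCov G C).ncard = ((Finset.range (k ^ 2)).filter P).card := by
    have : edgesCov G C = e '' ((Finset.range (k ^ 2)).filter P : Finset ℕ) := by
      ext x
      simp only [edgesCov, hE, Set.mem_ofPred_eq, Set.mem_image, Finset.coe_filter,
        Finset.coe_range, Set.mem_Iio, Finset.mem_range]
      constructor
      · rintro ⟨⟨p, hp, rfl⟩, h⟩
        exact ⟨p, ⟨hp, (hP p hp).1 h⟩, rfl⟩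
      · rintro ⟨p, ⟨hp, h⟩, rfl⟩
        exact ⟨⟨p, hp, rfl⟩, (hP p hp).2 h⟩
    rw [this, (he_inj.mono (Finset.coe_subset.2 (Finset.filter_subset _ _))).ncard_image,
      Set.ncard_coe_finset]
  let w : Fin k → Fin k ⊕ Fin (k ^ 2) := fun i => Sum.inr (Fin.castLE hksq i)
  have hw_mem (i : Fin k) (p : ℕ) : w i ∈ e p ↔ (t p : ℕ) = i := by
    simp [w, e, Fin.ext_iff, eq_comm]
  have hprefix (i : ℕ) (hi : i ≤ k) {p : ℕ} (hp : p < k ^ 2) :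
      (∃ j : Fin k, (j : ℕ) < i ∧ w j ∈ e p) ↔ uncovered k i ≤ p := by
    simp only [hw_mem, ← ht p hp]
    exact ⟨by rintro ⟨j, hj, h⟩; omega, fun h => ⟨⟨t p, by omega⟩, h, rfl⟩⟩
  have hcov_union (i : Fin k) (v) :
      (edgesCov G ((w '' {j | j < i}) ∪ {v})).ncard =
        ((Finset.range (k ^ 2)).filter fun p => uncovered k i ≤ p ∨ v ∈ e p).card := by
    refine hcov _ _ fun p hp => ?_
    rw [← hprefix i i.2.le hp]
    simp only [Set.mem_union, Set.mem_singleton_iff, or_and_right, exists_or, exists_eq_left,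
      Set.exists_mem_image, Set.mem_ofPred_eq, Fin.lt_def]
  have hcard_ge (i : ℕ) :
      ((Finset.range (k ^ 2)).filter fun p => uncovered k i ≤ p).card =
        k ^ 2 - uncovered k i := by
    rw [← Nat.card_Ico]
    congr 1
    ext p
    simp [and_comm]
  have hmarginal (i : Fin k) (v) :
      ((Finset.range (uncovered k i)).filter fun p => v ∈ e p).card ≤
        (uncovered k i + k - 1) / k := by
    rcases v with u | j
    · refine le_trans (Finset.card_le_card fun p hp => ?_)
        (card_filter_mod_eq_le hk (uncovered k i) u)
      simp only [Finset.mem_filter, e, Sym2.mem_iff, Sum.inl.injEq, reduceCtorEq, or_false] at hp ⊢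
      exact ⟨hp.1, by rw [hp.2]⟩
    · have hsub : ((Finset.range (uncovered k i)).filter fun p => Sum.inr j ∈ e p) ⊆
          Finset.Ico (uncovered k (j + 1)) (min (uncovered k i) (uncovered k j)) := by
        intro p hp
        simp only [Finset.mem_filter, Finset.mem_range, e, Sym2.mem_iff, reduceCtorEq,
          Sum.inr.injEq, false_or] at hp
        obtain ⟨hp, rfl⟩ := hp
        have := ht_eq (hp.trans_le (uncovered_le k i))
        simp only [Finset.mem_Ico, lt_min_iff]
        exact ⟨this.1, hp, this.2⟩
      refine (Finset.card_le_card hsub).trans ?_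
      rw [Nat.card_Ico]
      have hstep := uncovered_succ_add hk j
      rcases lt_or_ge (j : ℕ) i with hji | hij
      · have := uncovered_antitone k (Nat.succ_le_of_lt hji)
        rw [Nat.sub_eq_zero_of_le ((min_le_left _ _).trans this)]
        exact Nat.zero_le _
      · have h := uncovered_antitone k hij
        have : (uncovered k j + k - 1) / k ≤ (uncovered k i + k - 1) / k :=
          Nat.div_le_div_right (by omega)
        have := min_le_right (uncovered k i) (uncovered k j)
        refine (Nat.sub_le_sub_right this _).trans ?_
        generalize (uncovered k i + k - 1) / k = c at *
        omega
  refine ⟨Fin k ⊕ Fin (k ^ 2), inferInstance, G, Set.range Sum.inl, Set.range Sum.inr, k, w, hk,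
    Set.isCompl_range_inl_range_inr.disjoint, Set.range_inl_union_range_inr, hadj, ?_,
    fun x y h => (hadj x y h).imp And.left And.right, fun i v => ?_, ?_⟩
  · rw [← Set.image_univ, Set.ncard_image_of_injective _ Sum.inl_injective]
    simp
  · have hwi : (edgesCov G ((w '' {j | j < i}) ∪ {w i})).ncard =
        k ^ 2 - uncovered k (i + 1) := by
      rw [hcov_union, ← hcard_ge]
      congr 1
      refine Finset.filter_congr fun p hp => ?_
      have hp := Finset.mem_range.1 hp
      rw [hw_mem, ← ht p hp, ← ht p hp]
      omega
    have hsplit : ((Finset.range (k ^ 2)).filter fun p => uncovered k i ≤ p ∨ v ∈ e p) ⊆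
        ((Finset.range (k ^ 2)).filter fun p => uncovered k i ≤ p) ∪
          ((Finset.range (uncovered k i)).filter fun p => v ∈ e p) := by
      intro p hp
      simp only [Finset.mem_filter, Finset.mem_union, Finset.mem_range] at hp ⊢
      rcases le_or_gt (uncovered k i) p with h | h
      · exact Or.inl ⟨hp.1, h⟩
      · exact Or.inr ⟨h, hp.2.resolve_left h.not_ge⟩
    have hcard := (Finset.card_le_card hsplit).trans (Finset.card_union_le _ _)
    rw [hcard_ge] at hcard
    have := hmarginal i v
    have := uncovered_succ_add hk i
    have := uncovered_le k i
    rw [hwi, hcov_union]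
    omega
  · have hrange : (edgesCov G (Set.range w)).ncard = k ^ 2 - uncovered k k := by
      rw [← hcard_ge]
      refine hcov _ _ fun p hp => ?_
      rw [← hprefix k le_rfl hp]
      simp
    rw [hrange, hE, he_inj.ncard_image, Set.ncard_coe_finset, Finset.card_range,
      Nat.cast_sub (uncovered_le k k)]
    have hk0 : (0 : ℝ) < k := by exact_mod_cast hk
    have hlow := le_uncovered hk k
    have hmul := mul_lt_mul_of_pos_left hlim (pow_pos hk0 2)
    have hself : (k : ℝ) ^ 2 * (1 / k) = k := by field_simp
    push_cast
    linarith
end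

section
/- Let U be a finite set and 𝓡 a collection of subsets of U such that every element x ∈ U belongs to exactly two sets of 𝓡. Then no 3-element subset of U is shattered by 𝓡; that is, the set system (U, 𝓡) has VC-dimension at most 2. -/
/-- if every element of `U` belongs to exactly two sets of `𝓡`,
then no 3-element subset of `U` is shattered by `𝓡`; i.e. the set system has
VC-dimension at most 2. -/
theorem statement10 {α : Type*} [DecidableEq α] (U : Finset α)
    (𝓡 : Finset (Finset α)) (hsub : ∀ R ∈ 𝓡, R ⊆ U)
    (h2 : ∀ x ∈ U, (𝓡.filter (fun R => x ∈ R)).card = 2) :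
    ∀ A ⊆ U, A.card = 3 → ¬ (∀ B ⊆ A, ∃ R ∈ 𝓡, R ∩ A = B) := by
  intro A hA hcard hshatter
  obtain ⟨a, b, c, hab, hac, hbc, rfl⟩ := Finset.card_eq_three.mp hcard
  obtain ⟨R₁, hR₁, h₁⟩ := hshatter {a} (by simp)
  obtain ⟨R₂, hR₂, h₂⟩ := hshatter {a, b} (by simp [Finset.insert_subset_iff])
  obtain ⟨R₃, hR₃, h₃⟩ := hshatter {a, b, c} subset_rfl
  have mem_of_trace {R B : Finset α} {x : α} (h : R ∩ {a, b, c} = B) (hx : x ∈ B) : x ∈ R :=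
    (Finset.mem_inter.mp (h ▸ hx)).1
  have notMem_of_trace {R B : Finset α} {x : α} (h : R ∩ {a, b, c} = B)
      (hxA : x ∈ ({a, b, c} : Finset α)) (hx : x ∉ B) : x ∉ R :=
    fun hxR => hx (h ▸ Finset.mem_inter.mpr ⟨hxR, hxA⟩)
  have hb₁ : b ∉ R₁ := notMem_of_trace h₁ (by simp) (by simp [hab.symm])
  have hc₁ : c ∉ R₁ := notMem_of_trace h₁ (by simp) (by simp [hac.symm])
  have hc₂ : c ∉ R₂ := notMem_of_trace h₂ (by simp) (by simp [hac.symm, hbc.symm])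
  have hb₂ : b ∈ R₂ := mem_of_trace h₂ (by simp)
  have hc₃ : c ∈ R₃ := mem_of_trace h₃ (by simp)
  have hlt : 2 < (𝓡.filter (fun R => a ∈ R)).card :=
    Finset.two_lt_card.mpr
      ⟨R₁, Finset.mem_filter.mpr ⟨hR₁, mem_of_trace h₁ (by simp)⟩,
        R₂, Finset.mem_filter.mpr ⟨hR₂, mem_of_trace h₂ (by simp)⟩,
        R₃, Finset.mem_filter.mpr ⟨hR₃, mem_of_trace h₃ (by simp)⟩,
        fun h => hb₁ (h ▸ hb₂), fun h => hc₁ (h ▸ hc₃), fun h => hc₂ (h ▸ hc₃)⟩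
  exact hlt.ne' (h2 a (hA (by simp)))
end

section
/- Let r and s be distinct positive integers, and let a₀, a₁, a₂, a₃, a₄ be the real coefficients defined by the polynomial identity (z − r)²(z − s)² = a₀ + a₁z + a₂z² + a₃z³ + a₄z⁴. Then a₀ = r²s² > 0, and setting y = −(1/a₀)·(a₁, a₂, a₃, a₄) ∈ ℝ⁴ and b_t = (t, t², t³, t⁴) ∈ ℝ⁴ for each positive integer t, the inequality y · b_t ≥ 1 holds if and only if t = r or t = s. -/
open Matrix

/-- with `(z−r)²(z−s)² = a₀ + a₁z + a₂z² + a₃z³ + a₄z⁴` for distinct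
positive integers `r ≠ s`, we have `a₀ = r²s² > 0`, and for
`y = −(1/a₀)(a₁,a₂,a₃,a₄)` and `b_t = (t,t²,t³,t⁴)`, the inequality `y · b_t ≥ 1`
holds iff `t = r` or `t = s`. -/
theorem statement11 (r s : ℕ) (hr : 0 < r) (hs : 0 < s) (hrs : r ≠ s)
    (a0 a1 a2 a3 a4 : ℝ)
    (hpoly : ∀ z : ℝ, (z - r) ^ 2 * (z - s) ^ 2
      = a0 + a1 * z + a2 * z ^ 2 + a3 * z ^ 3 + a4 * z ^ 4) :
    a0 = (r : ℝ) ^ 2 * (s : ℝ) ^ 2 ∧ 0 < a0 ∧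
    ∀ t : ℕ, 0 < t →
      ((![-(1 / a0) * a1, -(1 / a0) * a2, -(1 / a0) * a3, -(1 / a0) * a4] : Fin 4 → ℝ)
          ⬝ᵥ ![(t : ℝ), (t : ℝ) ^ 2, (t : ℝ) ^ 3, (t : ℝ) ^ 4] ≥ 1
        ↔ t = r ∨ t = s) := by
  have h0 : a0 = (r : ℝ) ^ 2 * (s : ℝ) ^ 2 := by
    have h := hpoly 0
    ring_nf at h
    linarith
  have hpos : 0 < a0 := by
    rw [h0]
    positivity
  refine ⟨h0, hpos, fun t _ => ?_⟩
  have hdot : (![-(1 / a0) * a1, -(1 / a0) * a2, -(1 / a0) * a3, -(1 / a0) * a4] : Fin 4 → ℝ)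
      ⬝ᵥ ![(t : ℝ), (t : ℝ) ^ 2, (t : ℝ) ^ 3, (t : ℝ) ^ 4]
      = 1 - (((t : ℝ) - r) * ((t : ℝ) - s)) ^ 2 / a0 := by
    rw [mul_pow, hpoly t]
    simp only [dotProduct, Fin.sum_univ_four, cons_val]
    field_simp
    ring
  rw [hdot, ge_iff_le, le_sub_self_iff, div_le_iff₀ hpos, zero_mul, sq_nonpos_iff,
    mul_eq_zero, sub_eq_zero, sub_eq_zero, Nat.cast_inj, Nat.cast_inj]
end

section
/- Let G be a finite graph with vertex set {v₁, …, v_n} and edge set {e₁, …, e_m}, and let s ≥ 0 be an integer. Construct a set U of 3m points in ℝ²: for each edge e_k with endpoints v_i and v_j, include the three points (6k−2, 2i), (6k, 0), (6k+2, 2j). Construct the collection 𝓡 of axis-parallel rectangles: for each edge e_k, the two rectangles r₁(e_k) = [6k−3, 6k+1] × [−1, 2n+1] and r₂(e_k) = [6k−1, 6k+3] × [−1, 2n+1]; and for each vertex v_i, the rectangle r(v_i) = [0, 6m+3] × [2i−1, 2i+1]. Then G has a vertex cover of size at most s if and only if there exist m + s rectangles in 𝓡 whose union contains all points of U. -/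
/-- The closed axis-parallel rectangle `[a,b] × [c,d]` in `ℝ²`. -/
def rect (a b c d : ℝ) : Set (ℝ × ℝ) :=
  {p : ℝ × ℝ | a ≤ p.1 ∧ p.1 ≤ b ∧ c ≤ p.2 ∧ p.2 ≤ d}

/-- The set `U` of `3m` points: for each edge `e_k` (`k = 1,…,m`, here `k.val + 1`)
with endpoints `v_i, v_j`, the points `(6k−2, 2i)`, `(6k, 0)`, `(6k+2, 2j)`. -/
def redPts (n m : ℕ) (e : Fin m → Fin n × Fin n) : Set (ℝ × ℝ) :=
  ⋃ k : Fin m,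
    {(6 * ((k.val : ℝ) + 1) - 2, 2 * (((e k).1.val : ℝ) + 1)),
     (6 * ((k.val : ℝ) + 1), (0 : ℝ)),
     (6 * ((k.val : ℝ) + 1) + 2, 2 * (((e k).2.val : ℝ) + 1))}

/-- The collection `𝓡` of rectangles: for each edge `e_k` the rectangles
`[6k−3, 6k+1] × [−1, 2n+1]` and `[6k−1, 6k+3] × [−1, 2n+1]`, and for each vertex
`v_i` the rectangle `[0, 6m+3] × [2i−1, 2i+1]`. -/
def redRects (n m : ℕ) : Set (Set (ℝ × ℝ)) :=
  (⋃ k : Fin m,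
    {rect (6 * ((k.val : ℝ) + 1) - 3) (6 * ((k.val : ℝ) + 1) + 1) (-1) (2 * (n : ℝ) + 1),
     rect (6 * ((k.val : ℝ) + 1) - 1) (6 * ((k.val : ℝ) + 1) + 3) (-1) (2 * (n : ℝ) + 1)}) ∪
  (⋃ i : Fin n, {rect 0 (6 * (m : ℝ) + 3) (2 * ((i.val : ℝ) + 1) - 1) (2 * ((i.val : ℝ) + 1) + 1)})

/-- The rectangle `r₁(e_k)`. -/
def leftRect (n : ℕ) {m : ℕ} (k : Fin m) : Set (ℝ × ℝ) :=
  rect (6 * ((k.val : ℝ) + 1) - 3) (6 * ((k.val : ℝ) + 1) + 1) (-1) (2 * (n : ℝ) + 1)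

/-- The rectangle `r₂(e_k)`. -/
def rightRect (n : ℕ) {m : ℕ} (k : Fin m) : Set (ℝ × ℝ) :=
  rect (6 * ((k.val : ℝ) + 1) - 1) (6 * ((k.val : ℝ) + 1) + 3) (-1) (2 * (n : ℝ) + 1)

/-- The rectangle `r(v_i)`. -/
def vertexRect {n : ℕ} (m : ℕ) (i : Fin n) : Set (ℝ × ℝ) :=
  rect 0 (6 * (m : ℝ) + 3) (2 * ((i.val : ℝ) + 1) - 1) (2 * ((i.val : ℝ) + 1) + 1)

/-- All rectangles of the construction, indexed by a sum type. -/
def indexedRect (n m : ℕ) : Fin m ⊕ (Fin m ⊕ Fin n) → Set (ℝ × ℝ) :=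
  Sum.elim (leftRect n) (Sum.elim (rightRect n) (vertexRect m))

theorem mem_redRects {n m : ℕ} {Q : Set (ℝ × ℝ)} :
    Q ∈ redRects n m ↔ (∃ k : Fin m, Q = leftRect n k) ∨ (∃ k : Fin m, Q = rightRect n k) ∨
      ∃ i : Fin n, Q = vertexRect m i := by
  simp only [redRects, leftRect, rightRect, vertexRect, Set.mem_union, Set.mem_iUnion,
    Set.mem_insert_iff, Set.mem_singleton_iff, exists_or, or_assoc]

theorem Fin.eq_of_cast_lt_add_one {N : ℕ} {k l : Fin N} (h₁ : (k.val : ℝ) < l.val + 1)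
    (h₂ : (l.val : ℝ) < k.val + 1) : k = l := by
  have h₁' : k.val < l.val + 1 := by exact_mod_cast h₁
  have h₂' : l.val < k.val + 1 := by exact_mod_cast h₂
  exact Fin.ext (by omega)

theorem mem_leftRect {n m : ℕ} {k l : Fin m} {a y : ℝ} (ha : |a| ≤ 2) (hy : -1 ≤ y)
    (hy' : y ≤ 2 * (n : ℝ) + 1) :
    (6 * ((l.val : ℝ) + 1) + a, y) ∈ leftRect n k ↔ k = l ∧ a ≤ 1 := by
  obtain ⟨ha₁, ha₂⟩ := abs_le.mp ha
  simp only [leftRect, rect, Set.mem_ofPred_eq]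
  constructor
  · rintro ⟨h₁, h₂, -, -⟩
    obtain rfl : k = l := Fin.eq_of_cast_lt_add_one (by linarith) (by linarith)
    exact ⟨rfl, by linarith⟩
  · rintro ⟨rfl, h⟩
    exact ⟨by linarith, by linarith, hy, hy'⟩

theorem mem_rightRect {n m : ℕ} {k l : Fin m} {a y : ℝ} (ha : |a| ≤ 2) (hy : -1 ≤ y)
    (hy' : y ≤ 2 * (n : ℝ) + 1) :
    (6 * ((l.val : ℝ) + 1) + a, y) ∈ rightRect n k ↔ k = l ∧ -1 ≤ a := by
  obtain ⟨ha₁, ha₂⟩ := abs_le.mp ha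
  simp only [rightRect, rect, Set.mem_ofPred_eq]
  constructor
  · rintro ⟨h₁, h₂, -, -⟩
    obtain rfl : k = l := Fin.eq_of_cast_lt_add_one (by linarith) (by linarith)
    exact ⟨rfl, by linarith⟩
  · rintro ⟨rfl, h⟩
    exact ⟨by linarith, by linarith, hy, hy'⟩

theorem mem_vertexRect {n m : ℕ} {i j : Fin n} {x : ℝ} (hx : 0 ≤ x) (hx' : x ≤ 6 * (m : ℝ) + 3) :
    (x, 2 * ((j.val : ℝ) + 1)) ∈ vertexRect m i ↔ i = j := by
  simp only [vertexRect, rect, Set.mem_ofPred_eq]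
  constructor
  · rintro ⟨-, -, h₁, h₂⟩
    exact Fin.eq_of_cast_lt_add_one (by linarith) (by linarith)
  · rintro rfl
    exact ⟨hx, hx', by linarith, by linarith⟩

theorem notMem_vertexRect_of_snd_eq_zero {n m : ℕ} {i : Fin n} (x : ℝ) :
    (x, (0 : ℝ)) ∉ vertexRect m i := by
  rintro ⟨-, -, h, -⟩
  have : (0 : ℝ) ≤ (i.val : ℝ) := Nat.cast_nonneg _
  simp only at h
  linarith

theorem Fin.cast_add_one_le {N : ℕ} (k : Fin N) : (k.val : ℝ) + 1 ≤ N := by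
  exact_mod_cast k.isLt

theorem indexedRect_injective (n m : ℕ) : Function.Injective (indexedRect n m) := by
  have hn : (0 : ℝ) ≤ n := Nat.cast_nonneg n
  have hm : (0 : ℝ) ≤ m := Nat.cast_nonneg m
  have h2 : |(2 : ℝ)| ≤ 2 := by norm_num
  have h2' : |(-2 : ℝ)| ≤ 2 := by norm_num
  have hy : (-1 : ℝ) ≤ 0 := by norm_num
  have hy' : (0 : ℝ) ≤ 2 * n + 1 := by linarith
  -- each rectangle contains a point that lies in no other rectangle
  have hleft (k l : Fin m) : (6 * ((l.val : ℝ) + 1) + -2, (0 : ℝ)) ∈ leftRect n k ↔ k = l := by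
    rw [mem_leftRect h2' hy hy']; norm_num
  have hleft' (k l : Fin m) : (6 * ((l.val : ℝ) + 1) + -2, (0 : ℝ)) ∉ rightRect n k := by
    rw [mem_rightRect h2' hy hy']; norm_num
  have hright (k l : Fin m) : (6 * ((l.val : ℝ) + 1) + 2, (0 : ℝ)) ∈ rightRect n k ↔ k = l := by
    rw [mem_rightRect h2 hy hy']; norm_num
  have hvertex (i j : Fin n) : ((0 : ℝ), 2 * ((j.val : ℝ) + 1)) ∈ vertexRect m i ↔ i = j :=
    mem_vertexRect le_rfl (by linarith)
  rintro (k | k | i) (l | l | j) h <;>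
    simp only [indexedRect, Sum.elim_inl, Sum.elim_inr] at h
  · rw [(hleft k l).mp (h ▸ (hleft l l).mpr rfl)]
  · exact absurd (h ▸ (hleft k k).mpr rfl) (hleft' l k)
  · exact absurd (h ▸ (hleft k k).mpr rfl) (notMem_vertexRect_of_snd_eq_zero _)
  · exact absurd (h ▸ (hleft l l).mpr rfl) (hleft' k l)
  · rw [(hright k l).mp (h ▸ (hright l l).mpr rfl)]
  · exact absurd (h ▸ (hright k k).mpr rfl) (notMem_vertexRect_of_snd_eq_zero _)
  · exact absurd (h ▸ (hleft l l).mpr rfl) (notMem_vertexRect_of_snd_eq_zero _)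
  · exact absurd (h ▸ (hright l l).mpr rfl) (notMem_vertexRect_of_snd_eq_zero _)
  · rw [(hvertex i j).mp (h ▸ (hvertex j j).mpr rfl)]

/-- A subset of the rectangles covers, for each `k`, the three points of the edge `e_k` iff it contains
`r₁(e_k)` or `r(v_i)`, `r₁(e_k)` or `r₂(e_k)`, and `r₂(e_k)` or `r(v_j)`. -/
theorem covers_redPts_iff {n m : ℕ} {e : Fin m → Fin n × Fin n} {T : Finset (Set (ℝ × ℝ))}
    (hT : (↑T : Set (Set (ℝ × ℝ))) ⊆ redRects n m) :
    (∀ p ∈ redPts n m e, ∃ Q ∈ T, p ∈ Q) ↔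
      ∀ k : Fin m, (leftRect n k ∈ T ∨ vertexRect m (e k).1 ∈ T) ∧
        (leftRect n k ∈ T ∨ rightRect n k ∈ T) ∧
        (rightRect n k ∈ T ∨ vertexRect m (e k).2 ∈ T) := by
  have covered (p : ℝ × ℝ) : (∃ Q ∈ T, p ∈ Q) ↔
      (∃ k : Fin m, leftRect n k ∈ T ∧ p ∈ leftRect n k) ∨
      (∃ k : Fin m, rightRect n k ∈ T ∧ p ∈ rightRect n k) ∨
      ∃ i : Fin n, vertexRect m i ∈ T ∧ p ∈ vertexRect m i := by
    constructor
    · rintro ⟨Q, hQ, hp⟩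
      rcases mem_redRects.mp (hT hQ) with ⟨k, rfl⟩ | ⟨k, rfl⟩ | ⟨i, rfl⟩
      exacts [.inl ⟨k, hQ, hp⟩, .inr (.inl ⟨k, hQ, hp⟩), .inr (.inr ⟨i, hQ, hp⟩)]
    · rintro (⟨k, hQ, hp⟩ | ⟨k, hQ, hp⟩ | ⟨i, hQ, hp⟩)
      exacts [⟨_, hQ, hp⟩, ⟨_, hQ, hp⟩, ⟨_, hQ, hp⟩]
  have hn : (0 : ℝ) ≤ n := Nat.cast_nonneg n
  have low (i : Fin n) : (-1 : ℝ) ≤ 2 * ((i.val : ℝ) + 1) := by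
    have : (0 : ℝ) ≤ (i.val : ℝ) := Nat.cast_nonneg _
    linarith
  have high (i : Fin n) : 2 * ((i.val : ℝ) + 1) ≤ 2 * (n : ℝ) + 1 := by
    have := i.cast_add_one_le
    linarith
  simp only [redPts, Set.mem_iUnion, Set.mem_insert_iff, Set.mem_singleton_iff,
    forall_exists_index, forall_comm (α := ℝ × ℝ) (β := Fin m), forall_eq_or_imp, forall_eq]
  refine forall_congr' fun k => ?_
  have hk : (0 : ℝ) ≤ (k.val : ℝ) := Nat.cast_nonneg _
  have hk' := k.cast_add_one_le
  refine and_congr ?_ (and_congr ?_ ?_)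
  · rw [covered, sub_eq_add_neg]
    simp only [mem_leftRect (show |(-2 : ℝ)| ≤ 2 by norm_num) (low _) (high _),
      mem_rightRect (show |(-2 : ℝ)| ≤ 2 by norm_num) (low _) (high _),
      mem_vertexRect (show (0 : ℝ) ≤ 6 * ((k.val : ℝ) + 1) + -2 by linarith)
        (show 6 * ((k.val : ℝ) + 1) + -2 ≤ 6 * (m : ℝ) + 3 by linarith)]
    norm_num
  · rw [covered, ← add_zero (6 * ((k.val : ℝ) + 1))]
    simp only [mem_leftRect (show |(0 : ℝ)| ≤ 2 by norm_num) (show (-1 : ℝ) ≤ 0 by norm_num)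
        (show (0 : ℝ) ≤ 2 * n + 1 by linarith),
      mem_rightRect (show |(0 : ℝ)| ≤ 2 by norm_num) (show (-1 : ℝ) ≤ 0 by norm_num)
        (show (0 : ℝ) ≤ 2 * n + 1 by linarith),
      notMem_vertexRect_of_snd_eq_zero]
    norm_num
  · rw [covered]
    simp only [mem_leftRect (show |(2 : ℝ)| ≤ 2 by norm_num) (low _) (high _),
      mem_rightRect (show |(2 : ℝ)| ≤ 2 by norm_num) (low _) (high _),
      mem_vertexRect (show (0 : ℝ) ≤ 6 * ((k.val : ℝ) + 1) + 2 by linarith)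
        (show 6 * ((k.val : ℝ) + 1) + 2 ≤ 6 * (m : ℝ) + 3 by linarith)]
    norm_num

open Classical in
theorem exists_rects_of_vertexCover {n m s : ℕ} {e : Fin m → Fin n × Fin n} {C : Finset (Fin n)}
    (hs : C.card ≤ s) (hC : ∀ k : Fin m, (e k).1 ∈ C ∨ (e k).2 ∈ C) :
    ∃ T : Finset (Set (ℝ × ℝ)), T.card ≤ m + s ∧ (↑T : Set (Set (ℝ × ℝ))) ⊆ redRects n m ∧
      ∀ p ∈ redPts n m e, ∃ Q ∈ T, p ∈ Q := by
  let f (k : Fin m) : Set (ℝ × ℝ) := if (e k).1 ∈ C then rightRect n k else leftRect n k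
  have hf (k : Fin m) : f k ∈ Finset.univ.image f ∪ C.image (vertexRect m) :=
    Finset.mem_union_left _ (Finset.mem_image_of_mem _ (Finset.mem_univ k))
  have hv {i : Fin n} (hi : i ∈ C) :
      vertexRect m i ∈ Finset.univ.image f ∪ C.image (vertexRect m) :=
    Finset.mem_union_right _ (Finset.mem_image_of_mem _ hi)
  have hT : (↑(Finset.univ.image f ∪ C.image (vertexRect m)) : Set (Set (ℝ × ℝ))) ⊆
      redRects n m := by
    intro Q hQ
    rw [mem_redRects]
    rcases Finset.mem_union.mp hQ with hQ | hQ
    · obtain ⟨k, -, rfl⟩ := Finset.mem_image.mp hQ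
      by_cases h : (e k).1 ∈ C
      · exact .inr (.inl ⟨k, if_pos h⟩)
      · exact .inl ⟨k, if_neg h⟩
    · obtain ⟨i, -, rfl⟩ := Finset.mem_image.mp hQ
      exact .inr (.inr ⟨i, rfl⟩)
  refine ⟨_, ?_, hT, (covers_redPts_iff hT).mpr fun k => ?_⟩
  · refine (Finset.card_union_le _ _).trans (add_le_add ?_ (Finset.card_image_le.trans hs))
    simpa using Finset.card_image_le (s := Finset.univ) (f := f)
  · have hk := hf k
    by_cases h : (e k).1 ∈ C
    · rw [show f k = rightRect n k from if_pos h] at hk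
      exact ⟨.inr (hv h), .inr hk, .inl hk⟩
    · rw [show f k = leftRect n k from if_neg h] at hk
      exact ⟨.inl hk, .inl hk, .inr (hv ((hC k).resolve_left h))⟩

open Classical in
theorem exists_vertexCover_of_rects {n m s : ℕ} {e : Fin m → Fin n × Fin n}
    {T : Finset (Set (ℝ × ℝ))} (hs : T.card ≤ m + s)
    (hT : (↑T : Set (Set (ℝ × ℝ))) ⊆ redRects n m)
    (hcover : ∀ p ∈ redPts n m e, ∃ Q ∈ T, p ∈ Q) :
    ∃ C : Finset (Fin n), C.card ≤ s ∧ ∀ k : Fin m, (e k).1 ∈ C ∨ (e k).2 ∈ C := by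
  rw [covers_redPts_iff hT] at hcover
  let L : Finset (Fin m) := {k | leftRect n k ∈ T}
  let R : Finset (Fin m) := {k | rightRect n k ∈ T}
  let V : Finset (Fin n) := {i | vertexRect m i ∈ T}
  have hunion : L ∪ R = Finset.univ := by
    ext k
    simpa [L, R] using (hcover k).2.1
  have hcard : L.card + (R.card + V.card) ≤ T.card := by
    rw [← Finset.card_disjSum, ← Finset.card_disjSum]
    refine Finset.card_le_card_of_injOn (indexedRect n m) ?_ (indexedRect_injective n m).injOn
    rintro (k | k | i) h <;> simpa [L, R, V, indexedRect] using h
  have hLR : m + (L ∩ R).card = L.card + R.card := by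
    rw [← Finset.card_union_add_card_inter, hunion, Finset.card_fin]
  refine ⟨V ∪ (L ∩ R).image fun k => (e k).1, ?_, fun k => ?_⟩
  · have h₁ := Finset.card_union_le V ((L ∩ R).image fun k => (e k).1)
    have h₂ := Finset.card_image_le (s := L ∩ R) (f := fun k => (e k).1)
    omega
  · obtain ⟨h₁, -, h₃⟩ := hcover k
    rcases h₁ with hl | hv
    · rcases h₃ with hr | hv
      · exact .inl (Finset.mem_union_right _
          (Finset.mem_image.mpr ⟨k, by simp [L, R, hl, hr], rfl⟩))
      · exact .inr (Finset.mem_union_left _ (by simpa [V] using hv))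
    · exact .inl (Finset.mem_union_left _ (by simpa [V] using hv))

/-- `G` (with `n` vertices and `m` edges, given by its endpoint
function `e`) has a vertex cover of size at most `s` iff there exist `m + s`
rectangles from the construction whose union contains all the constructed points. -/
theorem statement12 (n m s : ℕ) (e : Fin m → Fin n × Fin n) :
    (∃ C : Finset (Fin n), C.card ≤ s ∧ ∀ k : Fin m, (e k).1 ∈ C ∨ (e k).2 ∈ C) ↔
    (∃ T : Finset (Set (ℝ × ℝ)), T.card ≤ m + s ∧
      (↑T : Set (Set (ℝ × ℝ))) ⊆ redRects n m ∧
      ∀ p ∈ redPts n m e, ∃ Q ∈ T, p ∈ Q) := by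
  exact ⟨fun ⟨_, hs, hC⟩ => exists_rects_of_vertexCover hs hC,
    fun ⟨_, hs, hT, hcover⟩ => exists_vertexCover_of_rects hs hT hcover⟩
end

section
/- Let (U, 𝓡, k) be an instance of weighted Maximum Coverage with weight function w : U → ℝ≥0, where U is a finite subset of ℝ² and every set in 𝓡 is of the form {x ∈ U : a · x ≥ b} for some a ∈ ℝ² and b ∈ ℝ (a halfplane intersected with U). Then the instance has covering multiplicity 2: for every k-tuple a₁, …, a_k of sets in 𝓡 there exists an optimal solution (o₁, …, o_k) — a k-tuple of sets in 𝓡 maximizing the weight of the union, whose union is denoted OPT — such that for each 1 ≤ i ≤ k there exist two indices j₁, j₂ with a_i ∩ OPT ⊆ o_{j₁} ∪ o_{j₂}. -/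
/-- The affine function `x ↦ n · x - b`, where `h = (n, b)`; the associated closed halfplane is
`{x | 0 ≤ affForm h x}`. -/
def affForm (h : (ℝ × ℝ) × ℝ) (x : ℝ × ℝ) : ℝ := h.1.1 * x.1 + h.1.2 * x.2 - h.2

/-- The convex combination of three affine forms with weights `c₁, c₂, c₃` is the constant `δ`.
When `0 ≤ δ`, the three halfplanes cover the plane. -/
structure IsConstCombo (h₁ h₂ h₃ : (ℝ × ℝ) × ℝ) (c₁ c₂ c₃ δ : ℝ) : Prop where
  nonneg₁ : 0 ≤ c₁
  nonneg₂ : 0 ≤ c₂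
  nonneg₃ : 0 ≤ c₃
  sum_eq_one : c₁ + c₂ + c₃ = 1
  combo_eq : ∀ x, c₁ * affForm h₁ x + c₂ * affForm h₂ x + c₃ * affForm h₃ x = δ

theorem IsConstCombo.swap₁₂ {h₁ h₂ h₃ : (ℝ × ℝ) × ℝ} {c₁ c₂ c₃ δ : ℝ}
    (H : IsConstCombo h₁ h₂ h₃ c₁ c₂ c₃ δ) : IsConstCombo h₂ h₁ h₃ c₂ c₁ c₃ δ :=
  ⟨H.nonneg₂, H.nonneg₁, H.nonneg₃, by linarith [H.sum_eq_one],
    fun x => by linarith [H.combo_eq x]⟩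

theorem IsConstCombo.swap₂₃ {h₁ h₂ h₃ : (ℝ × ℝ) × ℝ} {c₁ c₂ c₃ δ : ℝ}
    (H : IsConstCombo h₁ h₂ h₃ c₁ c₂ c₃ δ) : IsConstCombo h₁ h₃ h₂ c₁ c₃ c₂ δ :=
  ⟨H.nonneg₁, H.nonneg₃, H.nonneg₂, by linarith [H.sum_eq_one],
    fun x => by linarith [H.combo_eq x]⟩

theorem IsConstCombo.cover {h₁ h₂ h₃ : (ℝ × ℝ) × ℝ} {c₁ c₂ c₃ δ : ℝ}
    (H : IsConstCombo h₁ h₂ h₃ c₁ c₂ c₃ δ) (hδ : 0 ≤ δ) (x : ℝ × ℝ) :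
    0 ≤ affForm h₁ x ∨ 0 ≤ affForm h₂ x ∨ 0 ≤ affForm h₃ x := by
  by_contra! hx
  obtain ⟨h1, h2, h3⟩ := hx
  have := H.combo_eq x
  have a1 := mul_nonneg H.nonneg₁ (neg_nonneg.2 h1.le)
  have a2 := mul_nonneg H.nonneg₂ (neg_nonneg.2 h2.le)
  have a3 := mul_nonneg H.nonneg₃ (neg_nonneg.2 h3.le)
  have b1 : c₁ * -affForm h₁ x = 0 := by linarith
  have b2 : c₂ * -affForm h₂ x = 0 := by linarith
  have b3 : c₃ * -affForm h₃ x = 0 := by linarith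
  have d1 : c₁ = 0 := by simpa [h1.ne] using b1
  have d2 : c₂ = 0 := by simpa [h2.ne] using b2
  have d3 : c₃ = 0 := by simpa [h3.ne] using b3
  linarith [H.sum_eq_one]

theorem IsConstCombo.cover_of_eq_zero {h₁ h₂ h₃ : (ℝ × ℝ) × ℝ} {c₁ c₂ c₃ δ : ℝ}
    (H : IsConstCombo h₁ h₂ h₃ c₁ c₂ c₃ δ) (hδ : 0 ≤ δ) (hc : c₃ = 0) (x : ℝ × ℝ) :
    0 ≤ affForm h₁ x ∨ 0 ≤ affForm h₂ x := by
  have H' : IsConstCombo h₁ h₂ h₂ c₁ c₂ c₃ δ :=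
    ⟨H.nonneg₁, H.nonneg₂, H.nonneg₃, H.sum_eq_one, fun x => by
      have := H.combo_eq x
      simp only [hc, zero_mul] at this ⊢
      exact this⟩
  simpa using H'.cover hδ x

/-- A finite union of closed halflines in `ℝ` is the union of two of them. -/
theorem exists_pair_cover_line {ι : Type*} [Finite ι] [Nonempty ι] (m c : ι → ℝ) :
    ∃ i j, ∀ l s, 0 ≤ m l * s + c l → 0 ≤ m i * s + c i ∨ 0 ≤ m j * s + c j := by
  by_cases h0 : ∃ i, m i = 0 ∧ 0 ≤ c i
  · obtain ⟨i, hm, hc⟩ := h0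
    exact ⟨i, i, fun l s _ => by simp [hm, hc]⟩
  push Not at h0
  have key : ∀ m' : ι → ℝ, ∃ i, ∀ l s, 0 < m' l → 0 ≤ m' l * s + c l → 0 ≤ m' i * s + c i := by
    intro m'
    by_cases hne : ∃ l, 0 < m' l
    · obtain ⟨i, hi, hmax⟩ := Set.exists_max_image {l | 0 < m' l} (fun l => c l / m' l)
        (Set.toFinite _) hne
      refine ⟨i, fun l s hl hs => ?_⟩
      have h1 : c l / m' l ≤ c i / m' i := hmax l hl
      have hi' : 0 < m' i := hi
      have h2 : 0 ≤ s + c l / m' l := by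
        have : s + c l / m' l = (m' l * s + c l) / m' l := by field_simp
        rw [this]; positivity
      have h3 : m' i * s + c i = m' i * (s + c i / m' i) := by field_simp
      rw [h3]
      exact mul_nonneg hi'.le (by linarith)
    · push Not at hne
      exact ⟨Classical.arbitrary ι, fun l s hl => absurd hl (hne l).not_gt⟩
  obtain ⟨i, hi⟩ := key m
  obtain ⟨j, hj⟩ := key (fun l => -m l)
  refine ⟨i, j, fun l s hs => ?_⟩
  rcases lt_trichotomy (m l) 0 with hl | hl | hl
  · right
    have := hj l (-s) (by simpa using hl) (by simpa using hs)
    simpa using this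
  · have := h0 l hl
    rw [hl] at hs
    linarith
  · exact .inl (hi l s hl hs)

/-- The part of a finite union of halfplanes on the boundary line of a halfplane is covered by two
of them. -/
theorem exists_pair_cover_boundary {ι : Type*} [Finite ι] [Nonempty ι] (o : ι → (ℝ × ℝ) × ℝ)
    (h : (ℝ × ℝ) × ℝ) (hn : ‖h.1‖ = 1) :
    ∃ i j, ∀ x, affForm h x = 0 → ∀ l, 0 ≤ affForm (o l) x →
      0 ≤ affForm (o i) x ∨ 0 ≤ affForm (o j) x := by
  obtain ⟨⟨a, d⟩, b⟩ := h
  have hpos : 0 < a ^ 2 + d ^ 2 := by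
    rcases eq_or_ne a 0 with rfl | ha
    · rcases eq_or_ne d 0 with rfl | hd
      · simp at hn
      · positivity
    · positivity
  obtain ⟨i, j, hij⟩ := exists_pair_cover_line
    (fun l => -(o l).1.1 * d + (o l).1.2 * a)
    (fun l => (o l).1.1 * (a * b / (a ^ 2 + d ^ 2)) + (o l).1.2 * (d * b / (a ^ 2 + d ^ 2))
      - (o l).2)
  refine ⟨i, j, fun x hx l hl => ?_⟩
  have hx' : a * x.1 + d * x.2 = b := by simp only [affForm] at hx; linarith
  have e : ∀ l, affForm (o l) x = (-(o l).1.1 * d + (o l).1.2 * a) *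
      ((a * x.2 - d * x.1) / (a ^ 2 + d ^ 2)) +
      ((o l).1.1 * (a * b / (a ^ 2 + d ^ 2)) + (o l).1.2 * (d * b / (a ^ 2 + d ^ 2))
      - (o l).2) := by
    intro l
    simp only [affForm]
    rw [← hx']
    field_simp
    ring
  rw [e] at hl
  rw [e i, e j]
  exact hij l _ hl

/-- Two points on different sides of the boundary line of `h` are joined through a point of that
line at which every affine form is a convex combination of its values at the two points. -/
theorem exists_crossing (h : (ℝ × ℝ) × ℝ) (x y : ℝ × ℝ) (hx : 0 ≤ affForm h x)
    (hy : affForm h y < 0) : ∃ r, affForm h r = 0 ∧ ∃ s t : ℝ, 0 < s ∧ 0 ≤ t ∧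
      ∀ g, affForm g r = s * affForm g x + t * affForm g y := by
  set u := affForm h x with hu
  set v := affForm h y with hv
  have hd : 0 < u - v := by linarith
  have main : ∀ g, affForm g ((-v / (u - v)) • x + (u / (u - v)) • y) =
      -v / (u - v) * affForm g x + u / (u - v) * affForm g y := by
    intro g
    have : -v / (u - v) + u / (u - v) = 1 := by field_simp; ring
    simp only [affForm, Prod.fst_add, Prod.snd_add, Prod.smul_fst, Prod.smul_snd, smul_eq_mul]
    linear_combination g.2 * this
  refine ⟨_, ?_, _, _, div_pos (by linarith) hd, div_nonneg hx hd.le, main⟩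
  rw [main, ← hu, ← hv]
  ring

/-- If two halfplanes cover the boundary line of `h` but not the whole halfplane of `h`, then a
nonnegative combination of the three affine forms is a nonnegative constant. -/
theorem exists_const_combo_of_cover_boundary (h h₁ h₂ : (ℝ × ℝ) × ℝ) (hn : ‖h.1‖ = 1)
    (hcov : ∀ x, affForm h x = 0 → 0 ≤ affForm h₁ x ∨ 0 ≤ affForm h₂ x)
    (x : ℝ × ℝ) (hx : 0 ≤ affForm h x) (hx₁ : affForm h₁ x < 0) (hx₂ : affForm h₂ x < 0) :
    ∃ p q γ δ : ℝ, 0 ≤ p ∧ 0 ≤ q ∧ 0 < γ ∧ 0 ≤ δ ∧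
      ∀ y, p * affForm h₁ y + q * affForm h₂ y + γ * affForm h y = δ := by
  obtain ⟨⟨a, d⟩, b⟩ := h
  obtain ⟨⟨a₁, d₁⟩, b₁⟩ := h₁
  obtain ⟨⟨a₂, d₂⟩, b₂⟩ := h₂
  have hpos : 0 < a ^ 2 + d ^ 2 := by
    rcases eq_or_ne a 0 with rfl | ha
    · rcases eq_or_ne d 0 with rfl | hd
      · simp at hn
      · positivity
    · positivity
  set D := a ^ 2 + d ^ 2 with hD
  set m₁ := -a₁ * d + d₁ * a with hm₁
  set m₂ := -a₂ * d + d₂ * a with hm₂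
  set u₁ := a₁ * (a * b / D) + d₁ * (d * b / D) - b₁ with hu₁
  set u₂ := a₂ * (a * b / D) + d₂ * (d * b / D) - b₂ with hu₂
  have hline : ∀ s : ℝ, 0 ≤ m₁ * s + u₁ ∨ 0 ≤ m₂ * s + u₂ := by
    intro s
    have h0 : affForm ((a, d), b) (a * b / D - d * s, d * b / D + a * s) = 0 := by
      simp only [affForm]
      field_simp
      rw [hD]; ring
    refine (hcov _ h0).imp (fun h => ?_) (fun h => ?_)
    · simp only [affForm] at h; rw [hm₁, hu₁]; linarith
    · simp only [affForm] at h; rw [hm₂, hu₂]; linarith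
  obtain ⟨p, q, hp, hq, hpq, hm, hu⟩ : ∃ p q : ℝ, 0 ≤ p ∧ 0 ≤ q ∧ 0 < p + q ∧
      p * m₁ + q * m₂ = 0 ∧ 0 ≤ p * u₁ + q * u₂ := by
    by_cases z₁ : m₁ = 0 ∧ 0 ≤ u₁
    · exact ⟨1, 0, by simp, by simp, by simp, by simp [z₁.1], by simpa using z₁.2⟩
    by_cases z₂ : m₂ = 0 ∧ 0 ≤ u₂
    · exact ⟨0, 1, by simp, by simp, by simp, by simp [z₂.1], by simpa using z₂.2⟩
    have neg : ∀ m u s : ℝ, m ≠ 0 → m * ((s - u) / m) + u = s := fun m u s hm => by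
      field_simp; ring
    have ne₁ : m₁ ≠ 0 := by
      intro hz
      have u₁neg : u₁ < 0 := by by_contra hh; exact z₁ ⟨hz, not_lt.1 hh⟩
      by_cases hz₂ : m₂ = 0
      · have := hline 0
        simp only [mul_zero, zero_add] at this
        exact this.elim (fun h => z₁ ⟨hz, h⟩) (fun h => z₂ ⟨hz₂, h⟩)
      · rcases hline ((-1 - u₂) / m₂) with h | h
        · rw [hz] at h; linarith
        · rw [neg _ _ _ hz₂] at h; linarith
    have ne₂ : m₂ ≠ 0 := by
      intro hz
      have u₂neg : u₂ < 0 := by by_contra hh; exact z₂ ⟨hz, not_lt.1 hh⟩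
      rcases hline ((-1 - u₁) / m₁) with h | h
      · rw [neg _ _ _ ne₁] at h; linarith
      · rw [hz] at h; linarith
    have opp : m₁ * m₂ < 0 := by
      by_contra! hh
      have hh' : 0 < m₁ * m₂ := lt_of_le_of_ne hh (mul_ne_zero ne₁ ne₂).symm
      rcases mul_pos_iff.1 hh' with ⟨g₁, g₂⟩ | ⟨g₁, g₂⟩
      · set s := min ((-1 - u₁) / m₁) ((-1 - u₂) / m₂)
        have l₁ := mul_le_mul_of_nonneg_left (min_le_left ((-1 - u₁) / m₁) ((-1 - u₂) / m₂)) g₁.le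
        have l₂ := mul_le_mul_of_nonneg_left (min_le_right ((-1 - u₁) / m₁) ((-1 - u₂) / m₂)) g₂.le
        have := neg m₁ u₁ (-1) ne₁
        have := neg m₂ u₂ (-1) ne₂
        rcases hline s with h | h <;> linarith
      · set s := max ((-1 - u₁) / m₁) ((-1 - u₂) / m₂)
        have l₁ := mul_le_mul_of_nonpos_left (le_max_left ((-1 - u₁) / m₁) ((-1 - u₂) / m₂)) g₁.le
        have l₂ := mul_le_mul_of_nonpos_left (le_max_right ((-1 - u₁) / m₁) ((-1 - u₂) / m₂)) g₂.le
        have := neg m₁ u₁ (-1) ne₁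
        have := neg m₂ u₂ (-1) ne₂
        rcases hline s with h | h <;> linarith
    have hm0 : |m₂| * m₁ + |m₁| * m₂ = 0 := by
      rcases mul_neg_iff.1 opp with ⟨g₁, g₂⟩ | ⟨g₁, g₂⟩
      · rw [abs_of_pos g₁, abs_of_neg g₂]; ring
      · rw [abs_of_neg g₁, abs_of_pos g₂]; ring
    have hp := abs_pos.2 ne₂
    have hq := abs_pos.2 ne₁
    refine ⟨|m₂|, |m₁|, hp.le, hq.le, by linarith, hm0, ?_⟩
    by_contra! hneg
    set p := |m₂|
    set q := |m₁|
    have e₁ := neg m₁ u₁ ((p * u₁ + q * u₂) / (p + q)) ne₁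
    set s := ((p * u₁ + q * u₂) / (p + q) - u₁) / m₁
    have hw : (p * u₁ + q * u₂) / (p + q) < 0 := div_neg_of_neg_of_pos hneg (by linarith)
    have hw' : (p + q) * ((p * u₁ + q * u₂) / (p + q)) = p * u₁ + q * u₂ := by field_simp
    set w := (p * u₁ + q * u₂) / (p + q)
    have e₂ : q * (m₂ * s + u₂) = q * w := by
      linear_combination s * hm0 - p * e₁ - hw'
    have e₂' := mul_left_cancel₀ hq.ne' e₂
    rcases hline s with h | h <;> linarith
  have hid : ∀ y, p * affForm ((a₁, d₁), b₁) y + q * affForm ((a₂, d₂), b₂) y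
      - (p * (a₁ * a + d₁ * d) + q * (a₂ * a + d₂ * d)) / D * affForm ((a, d), b) y
      = p * u₁ + q * u₂ := by
    intro y
    have : (p * m₁ + q * m₂) * (a * y.2 - d * y.1) = 0 := by rw [hm, zero_mul]
    rw [hm₁, hm₂] at this
    rw [hu₁, hu₂]
    simp only [affForm]
    field_simp
    rw [hD]
    linear_combination this
  refine ⟨p, q, -((p * (a₁ * a + d₁ * d) + q * (a₂ * a + d₂ * d)) / D), p * u₁ + q * u₂,
    hp, hq, ?_, hu, fun y => by rw [← hid y]; ring⟩
  have hlt : p * affForm ((a₁, d₁), b₁) x + q * affForm ((a₂, d₂), b₂) x < 0 := by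
    rcases hp.eq_or_lt with rfl | hp'
    · have : 0 < q := by linarith
      have := mul_neg_of_pos_of_neg this hx₂
      linarith
    · have i₁ := mul_neg_of_pos_of_neg hp' hx₁
      have i₂ := mul_nonpos_of_nonneg_of_nonpos hq hx₂.le
      linarith
  have := hid x
  by_contra! hκ
  have := mul_nonneg (neg_nonpos.1 hκ) hx
  linarith

/-- Exchanging `h₃` for `h` in a constant convex combination increases the constant. -/
theorem IsConstCombo.exchange_lt {h₁ h₂ h₃ h : (ℝ × ℝ) × ℝ} {c₁ c₂ c₃ δ p q γ δ' : ℝ}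
    (H : IsConstCombo h₁ h₂ h₃ c₁ c₂ c₃ δ) (hc₂ : 0 < c₂) (hc₃ : 0 < c₃) (hδ : 0 ≤ δ)
    (hn₁ : ‖h₁.1‖ = 1) (hn₃ : ‖h₃.1‖ = 1) (hn : ‖h.1‖ = 1)
    (hp : 0 ≤ p) (hq : 0 ≤ q) (hγ : 0 < γ)
    (hid : ∀ y, p * affForm h₁ y + q * affForm h₂ y + γ * affForm h y = δ')
    (hD : 0 ≤ q * c₁ - p * c₂)
    (y : ℝ × ℝ) (hy : 0 ≤ affForm h y) (hy₁ : affForm h₁ y < 0) (hy₃ : affForm h₃ y < 0) :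
    δ * (p + q + γ) < δ' := by
  have n₁ : c₁ • h₁.1 + c₂ • h₂.1 + c₃ • h₃.1 = 0 := by
    have z := H.combo_eq (0, 0)
    have e := H.combo_eq (1, 0)
    have f := H.combo_eq (0, 1)
    simp only [affForm] at z e f
    ext
    · simp; linarith
    · simp; linarith
  have n₂ : p • h₁.1 + q • h₂.1 + γ • h.1 = 0 := by
    have z := hid (0, 0)
    have e := hid (1, 0)
    have f := hid (0, 1)
    simp only [affForm] at z e f
    ext
    · simp; linarith
    · simp; linarith
  have hq' : 0 < q := by
    rcases hq.eq_or_lt with rfl | h'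
    · exfalso
      have : p = 0 := by
        by_contra hne
        have := mul_pos (lt_of_le_of_ne hp (Ne.symm hne)) hc₂
        linarith
      subst this
      have h0 : h.1 = 0 := by simpa [hγ.ne'] using n₂
      simp [h0] at hn
    · exact h'
  have v : (c₂ * γ) • h.1 = (q * c₁ - p * c₂) • h₁.1 + (q * c₃) • h₃.1 := by
    linear_combination (norm := module) c₂ • n₂ - q • n₁
  have hnorm : c₂ * γ ≤ (q * c₁ - p * c₂) + q * c₃ := by
    have t := norm_add_le ((q * c₁ - p * c₂) • h₁.1) ((q * c₃) • h₃.1)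
    rw [← v] at t
    simp only [norm_smul, hn, hn₁, hn₃, mul_one, Real.norm_eq_abs] at t
    rwa [abs_of_nonneg (by positivity), abs_of_nonneg hD, abs_of_nonneg (by positivity)] at t
  have hs : c₂ * (p + q + γ) ≤ q := by
    have : q * (c₁ + c₂ + c₃) = q := by rw [H.sum_eq_one, mul_one]
    linarith
  have hlt : q * δ < c₂ * δ' := by
    have i₁ := H.combo_eq y
    have i₂ := hid y
    have i₃ := mul_nonneg hγ.le hy
    have i₄ := mul_neg_of_pos_of_neg hc₃ hy₃
    have i₅ := mul_nonpos_of_nonneg_of_nonpos hD hy₁.le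
    have i₆ := mul_nonneg hc₂.le i₃
    have i₇ := mul_neg_of_pos_of_neg hq' i₄
    have : q * δ - c₂ * δ' = (q * c₁ - p * c₂) * affForm h₁ y + q * (c₃ * affForm h₃ y)
        - c₂ * (γ * affForm h y) := by
      rw [← i₁, ← i₂]; ring
    linarith
  have := mul_le_mul_of_nonneg_left hs hδ
  by_contra! hcon
  have := mul_le_mul_of_nonneg_left hcon hc₂.le
  linarith

/-- A constant convex combination of forms from a finite set with the largest constant. -/
theorem exists_max_isConstCombo (T : Set ((ℝ × ℝ) × ℝ)) (hT : T.Finite)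
    {g₁ g₂ g₃ : (ℝ × ℝ) × ℝ} {e₁ e₂ e₃ δ₀ : ℝ} (hg₁ : g₁ ∈ T) (hg₂ : g₂ ∈ T) (hg₃ : g₃ ∈ T)
    (H : IsConstCombo g₁ g₂ g₃ e₁ e₂ e₃ δ₀) :
    ∃ h₁ ∈ T, ∃ h₂ ∈ T, ∃ h₃ ∈ T, ∃ c₁ c₂ c₃ δ, IsConstCombo h₁ h₂ h₃ c₁ c₂ c₃ δ ∧ δ₀ ≤ δ ∧
      ∀ h₁' ∈ T, ∀ h₂' ∈ T, ∀ h₃' ∈ T, ∀ c₁' c₂' c₃' δ',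
        IsConstCombo h₁' h₂' h₃' c₁' c₂' c₃' δ' → δ' ≤ δ := by
  let val : ((ℝ × ℝ) × ℝ) × ((ℝ × ℝ) × ℝ) × ((ℝ × ℝ) × ℝ) → Set ℝ := fun t =>
    {δ | ∃ c₁ c₂ c₃, IsConstCombo t.1 t.2.1 t.2.2 c₁ c₂ c₃ δ}
  have hcomp : ∀ t, IsCompact (val t) := by
    intro t
    let f : ℝ × ℝ → ℝ × ℝ × ℝ → ℝ := fun x c =>
      c.1 * affForm t.1 x + c.2.1 * affForm t.2.1 x + c.2.2 * affForm t.2.2 x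
    have hf : ∀ x, Continuous (f x) := fun x => by fun_prop
    let K : Set (ℝ × ℝ × ℝ) := Set.Icc 0 1 ∩ ({c | c.1 + c.2.1 + c.2.2 = 1} ∩
      ⋂ x, {c | f x c = f 0 c})
    have hK : IsCompact K := by
      refine isCompact_Icc.inter_right (IsClosed.inter ?_ (isClosed_iInter fun x => ?_))
      · exact isClosed_eq (by fun_prop) (by fun_prop)
      · exact isClosed_eq (hf x) (hf 0)
    have : val t = f 0 '' K := by
      ext δ
      constructor
      · rintro ⟨c₁, c₂, c₃, h⟩
        refine ⟨(c₁, c₂, c₃), ⟨⟨⟨h.nonneg₁, h.nonneg₂, h.nonneg₃⟩, ?_, ?_, ?_⟩, h.sum_eq_one, ?_⟩,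
          h.combo_eq 0⟩
        · have := h.sum_eq_one; have := h.nonneg₂; have := h.nonneg₃
          change c₁ ≤ 1; linarith
        · have := h.sum_eq_one; have := h.nonneg₁; have := h.nonneg₃
          change c₂ ≤ 1; linarith
        · have := h.sum_eq_one; have := h.nonneg₁; have := h.nonneg₂
          change c₃ ≤ 1; linarith
        · exact Set.mem_iInter.2 fun x => (h.combo_eq x).trans (h.combo_eq 0).symm
      · rintro ⟨⟨c₁, c₂, c₃⟩, ⟨⟨⟨p₁, p₂, p₃⟩, -⟩, hs, hx⟩, rfl⟩
        exact ⟨c₁, c₂, c₃, p₁, p₂, p₃, hs, fun x => Set.mem_iInter.1 hx x⟩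
    rw [this]
    exact hK.image (hf 0)
  have hTT : (T ×ˢ T ×ˢ T).Finite := hT.prod (hT.prod hT)
  have hmem : δ₀ ∈ ⋃ t ∈ T ×ˢ T ×ˢ T, val t :=
    Set.mem_biUnion (x := (g₁, g₂, g₃)) ⟨hg₁, hg₂, hg₃⟩ ⟨e₁, e₂, e₃, H⟩
  obtain ⟨δ, hδ, hmax⟩ := (hTT.isCompact_biUnion fun t _ => hcomp t).exists_isGreatest ⟨_, hmem⟩
  obtain ⟨⟨h₁, h₂, h₃⟩, ⟨m₁, m₂, m₃⟩, c₁, c₂, c₃, hc⟩ := Set.mem_iUnion₂.1 hδ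
  refine ⟨h₁, m₁, h₂, m₂, h₃, m₃, c₁, c₂, c₃, δ, hc, hmax hmem, ?_⟩
  intro h₁' m₁' h₂' m₂' h₃' m₃' c₁' c₂' c₃' δ' hc'
  exact hmax (Set.mem_biUnion (x := (h₁', h₂', h₃')) ⟨m₁', m₂', m₃'⟩ ⟨c₁', c₂', c₃', hc'⟩)

/-- The halfplane of `h` is contained in the union of the halfplanes of `h₁` and `h₂`. -/
def CoveredBy (h h₁ h₂ : (ℝ × ℝ) × ℝ) : Prop :=
  ∀ x, 0 ≤ affForm h x → 0 ≤ affForm h₁ x ∨ 0 ≤ affForm h₂ x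

theorem isConstCombo_div {h₁ h₂ h : (ℝ × ℝ) × ℝ} {p q γ δ : ℝ} (hp : 0 ≤ p) (hq : 0 ≤ q)
    (hγ : 0 < γ) (hid : ∀ y, p * affForm h₁ y + q * affForm h₂ y + γ * affForm h y = δ) :
    IsConstCombo h₁ h₂ h (p / (p + q + γ)) (q / (p + q + γ)) (γ / (p + q + γ))
      (δ / (p + q + γ)) where
  nonneg₁ := by positivity
  nonneg₂ := by positivity
  nonneg₃ := by positivity
  sum_eq_one := by field_simp
  combo_eq x := by rw [← hid x]; field_simp

/-- For a combination with maximal constant, a further halfplane is covered by two of the three,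
provided that the first two cover its boundary line. -/
theorem coveredBy_of_max_of_boundary (T : Set ((ℝ × ℝ) × ℝ)) (hT : ∀ h ∈ T, ‖h.1‖ = 1)
    {h₁ h₂ h₃ h : (ℝ × ℝ) × ℝ} {c₁ c₂ c₃ δ : ℝ}
    (hh₁ : h₁ ∈ T) (hh₂ : h₂ ∈ T) (hh₃ : h₃ ∈ T) (hh : h ∈ T)
    (H : IsConstCombo h₁ h₂ h₃ c₁ c₂ c₃ δ) (hδ : 0 ≤ δ)
    (hmax : ∀ h₁' ∈ T, ∀ h₂' ∈ T, ∀ h₃' ∈ T, ∀ c₁' c₂' c₃' δ',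
        IsConstCombo h₁' h₂' h₃' c₁' c₂' c₃' δ' → δ' ≤ δ)
    (hcov : ∀ x, affForm h x = 0 → 0 ≤ affForm h₁ x ∨ 0 ≤ affForm h₂ x) :
    CoveredBy h h₁ h₂ ∨ CoveredBy h h₁ h₃ ∨ CoveredBy h h₂ h₃ := by
  rcases H.nonneg₁.eq_or_lt with hc₁ | hc₁
  · exact .inr (.inr fun x _ => H.swap₁₂.swap₂₃.cover_of_eq_zero hδ hc₁.symm x)
  rcases H.nonneg₂.eq_or_lt with hc₂ | hc₂
  · exact .inr (.inl fun x _ => H.swap₂₃.cover_of_eq_zero hδ hc₂.symm x)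
  rcases H.nonneg₃.eq_or_lt with hc₃ | hc₃
  · exact .inl fun x _ => H.cover_of_eq_zero hδ hc₃.symm x
  by_contra! hcon
  obtain ⟨k₁₂, k₁₃, k₂₃⟩ := hcon
  simp only [CoveredBy] at k₁₂ k₁₃ k₂₃
  push Not at k₁₂ k₁₃ k₂₃
  obtain ⟨x, hx, hx₁, hx₂⟩ := k₁₂
  obtain ⟨y, hy, hy₁, hy₃⟩ := k₁₃
  obtain ⟨z, hz, hz₂, hz₃⟩ := k₂₃
  obtain ⟨p, q, γ, δ', hp, hq, hγ, -, hid⟩ :=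
    exists_const_combo_of_cover_boundary h h₁ h₂ (hT h hh) hcov x hx hx₁ hx₂
  have hle := hmax _ hh₁ _ hh₂ _ hh _ _ _ _ (isConstCombo_div hp hq hγ hid)
  rw [div_le_iff₀ (by positivity)] at hle
  rcases le_total 0 (q * c₁ - p * c₂) with hD | hD
  · exact hle.not_gt (H.exchange_lt hc₂ hc₃ hδ (hT _ hh₁) (hT _ hh₃) (hT _ hh) hp hq hγ hid hD
      y hy hy₁ hy₃)
  · have := H.swap₁₂.exchange_lt hc₁ hc₃ hδ (hT _ hh₂) (hT _ hh₃) (hT _ hh) hq hp hγ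
      (fun y => by linarith [hid y]) (by linarith) z hz hz₂ hz₃
    rw [add_comm q p] at this
    exact hle.not_gt this

theorem CoveredBy.symm {h h₁ h₂ : (ℝ × ℝ) × ℝ} (H : CoveredBy h h₁ h₂) : CoveredBy h h₂ h₁ :=
  fun x hx => (H x hx).symm

/-- For a combination with maximal constant, every further halfplane is covered by two of the
three. -/
theorem coveredBy_of_max (T : Set ((ℝ × ℝ) × ℝ)) (hT : ∀ h ∈ T, ‖h.1‖ = 1)
    {h₁ h₂ h₃ h : (ℝ × ℝ) × ℝ} {c₁ c₂ c₃ δ : ℝ}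
    (hh₁ : h₁ ∈ T) (hh₂ : h₂ ∈ T) (hh₃ : h₃ ∈ T) (hh : h ∈ T)
    (H : IsConstCombo h₁ h₂ h₃ c₁ c₂ c₃ δ) (hδ : 0 ≤ δ)
    (hmax : ∀ h₁' ∈ T, ∀ h₂' ∈ T, ∀ h₃' ∈ T, ∀ c₁' c₂' c₃' δ',
        IsConstCombo h₁' h₂' h₃' c₁' c₂' c₃' δ' → δ' ≤ δ) :
    CoveredBy h h₁ h₂ ∨ CoveredBy h h₁ h₃ ∨ CoveredBy h h₂ h₃ := by
  have hpair : (∀ x, affForm h x = 0 → 0 ≤ affForm h₁ x ∨ 0 ≤ affForm h₂ x) ∨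
      (∀ x, affForm h x = 0 → 0 ≤ affForm h₁ x ∨ 0 ≤ affForm h₃ x) ∨
      (∀ x, affForm h x = 0 → 0 ≤ affForm h₂ x ∨ 0 ≤ affForm h₃ x) := by
    obtain ⟨i, j, hij⟩ := exists_pair_cover_boundary ![h₁, h₂, h₃] h (hT h hh)
    have hij' : ∀ x, affForm h x = 0 →
        0 ≤ affForm (![h₁, h₂, h₃] i) x ∨ 0 ≤ affForm (![h₁, h₂, h₃] j) x := by
      intro x hx
      rcases H.cover hδ x with h | h | h
      · exact hij x hx 0 h
      · exact hij x hx 1 h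
      · exact hij x hx 2 h
    clear hij
    fin_cases i <;> fin_cases j <;> simp at hij' <;> grind
  rcases hpair with hc | hc | hc
  · exact coveredBy_of_max_of_boundary T hT hh₁ hh₂ hh₃ hh H hδ hmax hc
  · rcases coveredBy_of_max_of_boundary T hT hh₁ hh₃ hh₂ hh H.swap₂₃ hδ hmax hc with h | h | h
    · exact .inr (.inl h)
    · exact .inl h
    · exact .inr (.inr h.symm)
  · rcases coveredBy_of_max_of_boundary T hT hh₂ hh₃ hh₁ hh H.swap₁₂.swap₂₃ hδ hmax hc
      with h | h | h
    · exact .inr (.inr h)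
    · exact .inl h.symm
    · exact .inr (.inl h.symm)

/-- A halfplane trace other than the whole set is cut out by a halfplane with normalized normal
vector. -/
theorem exists_normalized_form (U R : Finset (ℝ × ℝ)) (hRU : R ⊆ U) (hne : R ≠ U)
    (hR : ∃ (a : ℝ × ℝ) (b : ℝ), ∀ x, x ∈ R ↔ x ∈ U ∧ a.1 * x.1 + a.2 * x.2 ≥ b) :
    ∃ h : (ℝ × ℝ) × ℝ, ‖h.1‖ = 1 ∧ ∀ x, x ∈ R ↔ x ∈ U ∧ 0 ≤ affForm h x := by
  obtain ⟨a, b, hab⟩ := hR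
  rcases eq_or_ne a 0 with rfl | ha
  · have hempty : R = ∅ := by
      by_contra hR
      obtain ⟨y, hy⟩ := Finset.nonempty_iff_ne_empty.2 hR
      have hb := ((hab y).1 hy).2
      refine hne (hRU.antisymm fun x hx => (hab x).2 ⟨hx, ?_⟩)
      simpa using hb
    obtain ⟨M, hM⟩ := (U.image Prod.fst).bddAbove
    refine ⟨((1, 0), M + 1), by simp [Prod.norm_def], fun x => ?_⟩
    simp only [hempty, Finset.notMem_empty, false_iff, not_and, not_le, affForm]
    intro hx
    have : x.1 ≤ M := hM (by simpa using ⟨x.2, hx⟩)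
    linarith
  · have hpos := norm_pos_iff.2 ha
    refine ⟨(‖a‖⁻¹ • a, ‖a‖⁻¹ * b), by simp [norm_smul, hpos.ne'], fun x => ?_⟩
    rw [hab x]
    have e : affForm (‖a‖⁻¹ • a, ‖a‖⁻¹ * b) x = ‖a‖⁻¹ * (a.1 * x.1 + a.2 * x.2 - b) := by
      simp only [affForm, Prod.smul_fst, Prod.smul_snd, smul_eq_mul]; ring
    rw [e, mul_nonneg_iff_of_pos_left (inv_pos.2 hpos), sub_nonneg]

/-- Among all tuples of maximal weight there is one whose image under a set-valued map `V` is
maximal. -/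
theorem exists_optimal_maximal {κ α β : Type*} [Fintype κ] [DecidableEq κ] [DecidableEq α]
    (𝓡 : Finset α) (h𝓡 : 𝓡.Nonempty) (weight : (κ → α) → ℝ) (V : (κ → α) → Set β) :
    ∃ o : κ → α, (∀ i, o i ∈ 𝓡) ∧ (∀ S : κ → α, (∀ i, S i ∈ 𝓡) → weight S ≤ weight o) ∧
      ∀ S : κ → α, (∀ i, S i ∈ 𝓡) → weight o ≤ weight S → V o ⊆ V S → V S ⊆ V o := by
  obtain ⟨R, hR⟩ := h𝓡
  obtain ⟨o₀, ho₀, hmax₀⟩ := (Fintype.piFinset fun _ : κ => 𝓡).exists_max_image weight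
    ⟨fun _ => R, by simpa using fun _ => hR⟩
  simp only [Fintype.mem_piFinset] at ho₀ hmax₀
  obtain ⟨o, ho, hmax⟩ := ((Fintype.piFinset fun _ : κ => 𝓡).filter
    fun S => weight o₀ ≤ weight S).exists_maximalFor V ⟨o₀, by simpa using ho₀⟩
  simp only [Finset.mem_filter, Fintype.mem_piFinset] at ho hmax
  refine ⟨o, ho.1, fun S hS => (hmax₀ S hS).trans ho.2, fun S hS hw hV => ?_⟩
  exact hmax ⟨hS, ho.2.trans hw⟩ hV

/-- a weighted Maximum Coverage instance in which `U ⊂ ℝ²` and every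
set of `𝓡` is a closed halfplane intersected with `U` has covering multiplicity 2:
for every `k`-tuple `a₁,…,a_k` from `𝓡` there is an optimal solution `(o₁,…,o_k)`
such that each `a_i ∩ OPT` is contained in the union of two of the `o_j`. -/
theorem statement13 (U : Finset (ℝ × ℝ)) (𝓡 : Finset (Finset (ℝ × ℝ)))
    (h𝓡 : 𝓡.Nonempty) (hsub : ∀ R ∈ 𝓡, R ⊆ U)
    (hhalf : ∀ R ∈ 𝓡, ∃ (a : ℝ × ℝ) (b : ℝ),
      ∀ x, x ∈ R ↔ x ∈ U ∧ a.1 * x.1 + a.2 * x.2 ≥ b)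
    (k : ℕ) (hk : 1 ≤ k) (w : ℝ × ℝ → ℝ) (hw : ∀ x, 0 ≤ w x) :
    ∀ a : Fin k → Finset (ℝ × ℝ), (∀ i, a i ∈ 𝓡) →
      ∃ o : Fin k → Finset (ℝ × ℝ), (∀ i, o i ∈ 𝓡) ∧
        (∀ S : Fin k → Finset (ℝ × ℝ), (∀ i, S i ∈ 𝓡) →
          ∑ x ∈ Finset.univ.sup S, w x ≤ ∑ x ∈ Finset.univ.sup o, w x) ∧
        (∀ i : Fin k, ∃ j₁ j₂ : Fin k,
          a i ∩ Finset.univ.sup o ⊆ o j₁ ∪ o j₂) := by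
  classical
  intro a ha
  have hU : ∀ S : Fin k → Finset (ℝ × ℝ), (∀ i, S i ∈ 𝓡) → Finset.univ.sup S ⊆ U :=
    fun S hS => Finset.sup_le fun i _ => hsub _ (hS i)
  have hmono : ∀ {A B : Finset (ℝ × ℝ)}, A ⊆ B → ∑ x ∈ A, w x ≤ ∑ x ∈ B, w x :=
    fun h => Finset.sum_le_sum_of_subset_of_nonneg h fun x _ _ => hw x
  have hmem : ∀ (S : Fin k → Finset (ℝ × ℝ)) x, x ∈ Finset.univ.sup S ↔ ∃ i, x ∈ S i := by
    intro S x; simp [Finset.mem_sup]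
  have : Nonempty (Fin k) := ⟨⟨0, hk⟩⟩
  by_cases hUR : U ∈ 𝓡
  · have hsup : U ⊆ Finset.univ.sup fun _ : Fin k => U :=
      Finset.le_sup (f := fun _ : Fin k => U) (Finset.mem_univ ⟨0, hk⟩)
    refine ⟨fun _ => U, fun _ => hUR, fun S hS => hmono ((hU S hS).trans hsup), fun i => ?_⟩
    refine ⟨⟨0, hk⟩, ⟨0, hk⟩, fun x hx => ?_⟩
    simpa using hsub _ (ha i) (Finset.mem_inter.1 hx).1
  have hform : ∀ R : Finset (ℝ × ℝ), ∃ h : (ℝ × ℝ) × ℝ, R ∈ 𝓡 →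
      ‖h.1‖ = 1 ∧ ∀ x, x ∈ R ↔ x ∈ U ∧ 0 ≤ affForm h x := by
    intro R
    by_cases hR : R ∈ 𝓡
    · obtain ⟨h, hh⟩ := exists_normalized_form U R (hsub R hR) (fun e => hUR (e ▸ hR)) (hhalf R hR)
      exact ⟨h, fun _ => hh⟩
    · exact ⟨0, fun h => absurd h hR⟩
  choose F hF using hform
  have hT : ∀ h ∈ F '' (𝓡 : Set (Finset (ℝ × ℝ))), ‖h.1‖ = 1 := by
    rintro _ ⟨R, hR, rfl⟩
    exact (hF R hR).1
  by_cases hcase : 3 ≤ k ∧ ∃ R₁ ∈ 𝓡, ∃ R₂ ∈ 𝓡, ∃ R₃ ∈ 𝓡, ∃ c₁ c₂ c₃ δ, 0 ≤ δ ∧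
      IsConstCombo (F R₁) (F R₂) (F R₃) c₁ c₂ c₃ δ
  · obtain ⟨hk3, R₁, hR₁, R₂, hR₂, R₃, hR₃, e₁, e₂, e₃, δ₀, hδ₀, H₀⟩ := hcase
    obtain ⟨_, ⟨S₁, hS₁, rfl⟩, _, ⟨S₂, hS₂, rfl⟩, _, ⟨S₃, hS₃, rfl⟩, c₁, c₂, c₃, δ, H, hle, hmax⟩ :=
      exists_max_isConstCombo (F '' 𝓡) (𝓡.finite_toSet.image F) ⟨R₁, hR₁, rfl⟩ ⟨R₂, hR₂, rfl⟩
        ⟨R₃, hR₃, rfl⟩ H₀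
    have hδ := hδ₀.trans hle
    let i₁ : Fin k := ⟨0, by omega⟩
    let i₂ : Fin k := ⟨1, by omega⟩
    let i₃ : Fin k := ⟨2, by omega⟩
    let o : Fin k → Finset (ℝ × ℝ) := fun i => if i = i₁ then S₁ else if i = i₂ then S₂ else S₃
    have o₁ : o i₁ = S₁ := by simp [o]
    have o₂ : o i₂ = S₂ := by simp [o, i₁, i₂]
    have o₃ : o i₃ = S₃ := by simp [o, i₁, i₂, i₃]
    have ho : ∀ i, o i ∈ 𝓡 := by
      intro i
      simp only [o]
      split_ifs <;> assumption
    refine ⟨o, ho, fun S hS => hmono ((hU S hS).trans fun x hx => ?_), fun i => ?_⟩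
    · rw [hmem]
      rcases H.cover hδ x with h | h | h
      · exact ⟨i₁, by rw [o₁]; exact ((hF S₁ hS₁).2 x).2 ⟨hx, h⟩⟩
      · exact ⟨i₂, by rw [o₂]; exact ((hF S₂ hS₂).2 x).2 ⟨hx, h⟩⟩
      · exact ⟨i₃, by rw [o₃]; exact ((hF S₃ hS₃).2 x).2 ⟨hx, h⟩⟩
    · have step : ∀ j₁ j₂ : Fin k, CoveredBy (F (a i)) (F (o j₁)) (F (o j₂)) →
          ∃ j₁ j₂ : Fin k, a i ∩ Finset.univ.sup o ⊆ o j₁ ∪ o j₂ := by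
        intro j₁ j₂ hj
        refine ⟨j₁, j₂, fun x hx => ?_⟩
        obtain ⟨hxU, hx⟩ := ((hF _ (ha i)).2 x).1 (Finset.mem_inter.1 hx).1
        rw [Finset.mem_union]
        exact (hj x hx).imp (fun h => ((hF _ (ho j₁)).2 x).2 ⟨hxU, h⟩)
          (fun h => ((hF _ (ho j₂)).2 x).2 ⟨hxU, h⟩)
      rcases coveredBy_of_max (F '' 𝓡) hT ⟨S₁, hS₁, rfl⟩ ⟨S₂, hS₂, rfl⟩ ⟨S₃, hS₃, rfl⟩
        ⟨a i, ha i, rfl⟩ H hδ hmax with h | h | h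
      · exact step i₁ i₂ (by rwa [o₁, o₂])
      · exact step i₁ i₃ (by rwa [o₁, o₃])
      · exact step i₂ i₃ (by rwa [o₂, o₃])
  obtain ⟨o, ho, hopt, hmax⟩ := exists_optimal_maximal 𝓡 h𝓡
    (fun S : Fin k → Finset (ℝ × ℝ) => ∑ x ∈ Finset.univ.sup S, w x)
    (fun S => {x | ∃ i, 0 ≤ affForm (F (S i)) x})
  refine ⟨o, ho, hopt, fun i => ?_⟩
  rcases lt_or_ge k 3 with hk3 | hk3
  · refine ⟨⟨0, hk⟩, ⟨k - 1, by omega⟩, fun x hx => ?_⟩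
    obtain ⟨j, hj⟩ := (hmem o x).1 (Finset.mem_inter.1 hx).2
    have : j = ⟨0, hk⟩ ∨ j = ⟨k - 1, by omega⟩ := by
      simp only [Fin.ext_iff]; omega
    rw [Finset.mem_union]
    rcases this with rfl | rfl
    · exact .inl hj
    · exact .inr hj
  have hn := (hF _ (ha i)).1
  obtain ⟨j₁, j₂, hj⟩ := exists_pair_cover_boundary (fun j => F (o j)) (F (a i)) hn
  refine ⟨j₁, j₂, fun x hx => ?_⟩
  obtain ⟨hxa, hxo⟩ := Finset.mem_inter.1 hx
  obtain ⟨l, hl⟩ := (hmem o x).1 hxo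
  obtain ⟨hxU, hxA⟩ := ((hF _ (ha i)).2 x).1 hxa
  have hxl := (((hF _ (ho l)).2 x).1 hl).2
  by_contra hnot
  rw [Finset.mem_union, not_or] at hnot
  have hx₁ : affForm (F (o j₁)) x < 0 := by
    by_contra! h; exact hnot.1 (((hF _ (ho j₁)).2 x).2 ⟨hxU, h⟩)
  have hx₂ : affForm (F (o j₂)) x < 0 := by
    by_contra! h; exact hnot.2 (((hF _ (ho j₂)).2 x).2 ⟨hxU, h⟩)
  have hl₁ : j₁ ≠ l := by rintro rfl; linarith
  have hl₂ : j₂ ≠ l := by rintro rfl; linarith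
  have hcov : ∀ y, 0 ≤ affForm (F (o l)) y → 0 ≤ affForm (F (a i)) y ∨
      0 ≤ affForm (F (o j₁)) y ∨ 0 ≤ affForm (F (o j₂)) y := by
    intro y hy
    by_contra! hneg
    obtain ⟨hyA, hy₁, hy₂⟩ := hneg
    obtain ⟨r, hr, s, t, hs, ht, hst⟩ := exists_crossing (F (a i)) x y hxA hyA
    have hrl : 0 ≤ affForm (F (o l)) r := by rw [hst]; positivity
    have hneg : ∀ g, affForm g x < 0 → affForm g y < 0 → affForm g r < 0 := by
      intro g h1 h2
      rw [hst]
      have := mul_neg_of_pos_of_neg hs h1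
      have := mul_nonpos_of_nonneg_of_nonpos ht h2.le
      linarith
    exact (hj r hr l hrl).elim (hneg _ hx₁ hy₁).not_ge (hneg _ hx₂ hy₂).not_ge
  -- Exchanging `o l` for `a i` loses nothing, so by maximality `a i` gains nothing in the plane.
  have hmemS : ∀ j, Function.update o l (a i) j ∈ 𝓡 := by
    intro j
    rcases eq_or_ne j l with rfl | hjl
    · simpa using ha i
    · simpa [hjl] using ho j
  have hV : ∀ y j, 0 ≤ affForm (F (o j)) y →
      ∃ j', 0 ≤ affForm (F (Function.update o l (a i) j')) y := by
    intro y j hy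
    rcases eq_or_ne j l with rfl | hjl
    · rcases hcov y hy with h | h | h
      · exact ⟨j, by simpa using h⟩
      · exact ⟨j₁, by simpa [hl₁] using h⟩
      · exact ⟨j₂, by simpa [hl₂] using h⟩
    · exact ⟨j, by simpa [hjl] using hy⟩
  have hA := hmax (Function.update o l (a i)) hmemS
    (hmono fun y hy => by
      obtain ⟨j, hyj⟩ := (hmem o y).1 hy
      obtain ⟨hyU, hyj⟩ := ((hF _ (ho j)).2 y).1 hyj
      obtain ⟨j', hj'⟩ := hV y j hyj
      exact (hmem _ y).2 ⟨j', ((hF _ (hmemS j')).2 y).2 ⟨hyU, hj'⟩⟩)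
    (fun y ⟨j, hyj⟩ => hV y j hyj)
  have hline : ∀ y, affForm (F (a i)) y = 0 →
      0 ≤ affForm (F (o j₁)) y ∨ 0 ≤ affForm (F (o j₂)) y := by
    intro y hy
    obtain ⟨j, hyj⟩ := hA (show y ∈ {y | ∃ j, 0 ≤ affForm (F (Function.update o l (a i) j)) y}
      from ⟨l, by simp [hy]⟩)
    exact hj y hy j hyj
  obtain ⟨p, q, γ, δ, hp, hq, hγ, hδ, hid⟩ :=
    exists_const_combo_of_cover_boundary _ _ _ hn hline x hxA hx₁ hx₂
  exact hcase ⟨hk3, _, ho j₁, _, ho j₂, _, ha i, _, _, _, _, div_nonneg hδ (by positivity),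
    isConstCombo_div hp hq hγ hid⟩
end

section
/- Let (U, 𝓡, k) be an instance of weighted Maximum Coverage with weight function w : U → ℝ≥0, where U is a finite subset of ℝ² and every set in 𝓡 is of the form {x ∈ U : a · x ≥ b} for some a ∈ ℝ² and b ∈ ℝ (a halfplane intersected with U). Let g₁, …, g_k be the sets chosen by the greedy algorithm, i.e., g_i ∈ 𝓡 maximizes w(g \ (g₁ ∪ ⋯ ∪ g_{i−1})) over g ∈ 𝓡. Then w(g₁ ∪ ⋯ ∪ g_k) ≥ (3/4) times the maximum, over k-tuples (S₁,…,S_k) of sets in 𝓡, of w(S₁ ∪ ⋯ ∪ S_k). -/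
/-- Outside `g`, a set `S a` covered by `g` and the other sets contributes nothing to the union. -/
theorem biUnion_sdiff_subset_of_redundant {α ι : Type*} [DecidableEq α] [DecidableEq ι]
    {S : ι → Finset α} {g : Finset α} {s s' : Finset ι} {a : ι}
    (ha : S a ⊆ g ∪ (s.erase a).biUnion S) (h : ∀ j, j ∈ s → j ≠ a → j ∈ s') :
    s.biUnion S \ g ⊆ s'.biUnion S \ g := by
  intro x hx
  obtain ⟨hx, hxg⟩ := Finset.mem_sdiff.1 hx
  obtain ⟨j, hj, hxj⟩ := Finset.mem_biUnion.1 hx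
  refine Finset.mem_sdiff.2 ⟨Finset.mem_biUnion.2 ?_, hxg⟩
  by_cases hja : j = a
  · subst hja
    obtain ⟨i, hi, hxi⟩ := Finset.mem_biUnion.1 ((Finset.mem_union.1 (ha hxj)).resolve_left hxg)
    exact ⟨i, h i (Finset.mem_of_mem_erase hi) (Finset.ne_of_mem_erase hi), hxi⟩
  · exact ⟨j, h j hj hja, hxj⟩

/-- Dropping the index `a` from a union loses at most `S a`. -/
theorem biUnion_sdiff_subset_union {α ι : Type*} [DecidableEq α] {S : ι → Finset α}
    {g : Finset α} {s s' : Finset ι} {a : ι} (h : ∀ j, j ∈ s → j ≠ a → j ∈ s') :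
    s.biUnion S \ g ⊆ (s'.biUnion S \ g) ∪ (S a \ g) := by
  intro x hx
  obtain ⟨hx, hxg⟩ := Finset.mem_sdiff.1 hx
  obtain ⟨j, hj, hxj⟩ := Finset.mem_biUnion.1 hx
  by_cases hja : j = a
  · exact Finset.mem_union_right _ (Finset.mem_sdiff.2 ⟨hja ▸ hxj, hxg⟩)
  · exact Finset.mem_union_left _
      (Finset.mem_sdiff.2 ⟨Finset.mem_biUnion.2 ⟨j, h j hj hja, hxj⟩, hxg⟩)

/-- One greedy step. The solution sets are split into unmarked ones `P` and marked ones `M`; the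
potential is `3/4` of the covered weight minus `1/4` of the weight of each marked set. If the greedy
set `g` makes some solution set redundant, or if two solution sets cover everything that `g` covers,
then `2 * |P| + |M|` can be lowered by two at the price of losing at most `w(g)` of the potential. -/
theorem exists_greedy_step {α ι : Type*} [DecidableEq α] [DecidableEq ι]
    (S : ι → Finset α) (g : Finset α) (w : α → ℝ) (hw : ∀ x, 0 ≤ w x) (P M : Finset ι)
    (hPM : Disjoint P M) (r : ℕ) (hr : 2 * P.card + M.card ≤ 2 * (r + 1))
    (hle : ∀ j ∈ P ∪ M, ∑ x ∈ S j, w x ≤ ∑ x ∈ g, w x)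
    (hgeo : (∃ j ∈ P ∪ M, S j ⊆ g ∪ ((P ∪ M).erase j).biUnion S) ∨
      ∃ a ∈ P ∪ M, ∃ b ∈ P ∪ M, g ∩ (P ∪ M).biUnion S ⊆ S a ∪ S b) :
    ∃ P' M' : Finset ι, Disjoint P' M' ∧ 2 * P'.card + M'.card ≤ 2 * r ∧
      3 / 4 * ∑ x ∈ (P ∪ M).biUnion S, w x - 1 / 4 * ∑ j ∈ M, ∑ x ∈ S j, w x ≤
        ∑ x ∈ g, w x + (3 / 4 * ∑ x ∈ (P' ∪ M').biUnion S \ g, w x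
          - 1 / 4 * ∑ j ∈ M', ∑ x ∈ S j \ g, w x) := by
  obtain ⟨f, hf⟩ : ∃ f : Finset α → ℝ, ∀ X, f X = ∑ x ∈ X, w x := ⟨_, fun _ => rfl⟩
  simp only [← hf] at hle ⊢
  have hpos : ∀ X, 0 ≤ f X := fun X => by rw [hf]; exact Finset.sum_nonneg fun x _ => hw x
  have hmono : ∀ {X Y}, X ⊆ Y → f X ≤ f Y := fun {X Y} h => by
    rw [hf, hf]; exact Finset.sum_le_sum_of_subset_of_nonneg h fun x _ _ => hw x
  have hunion : ∀ X Y, f (X ∪ Y) ≤ f X + f Y := fun X Y => by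
    have := Finset.sum_union_inter (s₁ := X) (s₂ := Y) (f := w)
    have := hpos (X ∩ Y)
    simp only [hf] at *; linarith
  have hsplit : ∀ X, f X = f (X ∩ g) + f (X \ g) := fun X => by
    rw [hf, hf, hf]; exact (Finset.sum_inter_add_sum_sdiff X g w).symm
  have hinter : ∀ X, f (X ∩ g) ≤ f g := fun X => hmono Finset.inter_subset_right
  have hdefect : ∀ N : Finset ι, ∑ j ∈ N, f (S j \ g) ≤ ∑ j ∈ N, f (S j) := fun N =>
    Finset.sum_le_sum fun j _ => hmono Finset.sdiff_subset
  have hcover : ∀ {X Y Z : Finset α}, X ⊆ Y ∪ Z → f X ≤ f Y + f Z := fun h =>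
    (hmono h).trans (hunion _ _)
  have hempty : f ∅ = 0 := by rw [hf]; simp
  have hbiUnion : ∀ (N : Finset ι) (R : ι → Finset α), f (N.biUnion R) ≤ ∑ j ∈ N, f (R j) := by
    intro N R
    induction N using Finset.induction_on with
    | empty => simp [hempty]
    | insert j N hj ih =>
      rw [Finset.biUnion_insert, Finset.sum_insert hj]
      linarith [hunion (R j) (N.biUnion R)]
  set T := (P ∪ M).biUnion S with hT
  have hTs := hsplit T
  have hTi := hinter T
  rcases hgeo with ⟨a, ha, hared⟩ | hcov
  · -- `a` is redundant
    rcases Finset.mem_union.1 ha with haP | haM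
    · have haM : a ∉ M := Finset.disjoint_left.1 hPM haP
      refine ⟨P.erase a, M, hPM.mono_left (Finset.erase_subset _ _), ?_, ?_⟩
      · have := Finset.card_erase_add_one haP
        omega
      · have h1 : f (T \ g) ≤ f ((P.erase a ∪ M).biUnion S \ g) := by
          refine hmono (biUnion_sdiff_subset_of_redundant hared fun j => ?_)
          simp only [Finset.mem_union, Finset.mem_erase]
          tauto
        have := hdefect M
        linarith [hpos g]
    · have haP : a ∉ P := Finset.disjoint_right.1 hPM haM
      have hcard := Finset.card_erase_add_one haM
      have hsum := Finset.add_sum_erase M (fun j => f (S j)) haM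
      have hsum' := Finset.add_sum_erase M (fun j => f (S j \ g)) haM
      have hd := hdefect (M.erase a)
      have hTe : T \ g ⊆ (P ∪ M.erase a).biUnion S \ g := by
        refine biUnion_sdiff_subset_of_redundant hared fun j => ?_
        simp only [Finset.mem_union, Finset.mem_erase]
        tauto
      rcases P.eq_empty_or_nonempty with rfl | ⟨c, hc⟩
      · rcases (M.erase a).eq_empty_or_nonempty with he | ⟨b, hb⟩
        · refine ⟨∅, ∅, by simp, by simp, ?_⟩
          have h1 : f (T \ g) ≤ 0 := by
            rw [← hempty]; apply hmono; simpa [he] using hTe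
          have h2 : 0 ≤ ∑ j ∈ M, f (S j) := Finset.sum_nonneg fun j _ => hpos _
          simp [hempty]
          linarith [hpos g]
        · refine ⟨∅, (M.erase a).erase b, by simp, ?_, ?_⟩
          · have := Finset.card_erase_add_one hb
            simp at hr ⊢
            omega
          · have h1 : f (T \ g) ≤
                f ((∅ ∪ (M.erase a).erase b).biUnion S \ g) + f (S b \ g) := by
              refine hcover (hTe.trans (biUnion_sdiff_subset_union fun j => ?_))
              simp only [Finset.mem_union, Finset.mem_erase]
              tauto
            have h2 : f (T ∩ g) ≤ ∑ j ∈ M, f (S j ∩ g) := by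
              have : T ∩ g = M.biUnion fun j => S j ∩ g := by
                rw [hT, Finset.empty_union, Finset.biUnion_inter]
              rw [this]
              exact hbiUnion _ _
            have h3 : ∑ j ∈ M, f (S j) = ∑ j ∈ M, f (S j ∩ g) + ∑ j ∈ M, f (S j \ g) := by
              rw [← Finset.sum_add_distrib]; exact Finset.sum_congr rfl fun j _ => hsplit _
            have h4 := Finset.add_sum_erase (M.erase a) (fun j => f (S j \ g)) hb
            have h5 := hle b (by simp [Finset.mem_of_mem_erase hb])
            have h6 := hmono (Finset.sdiff_subset : S b \ g ⊆ S b)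
            have h7 := hpos (S a \ g)
            linarith
      · have hcM : c ∉ M.erase a := fun h =>
          Finset.disjoint_left.1 hPM hc (Finset.mem_of_mem_erase h)
        refine ⟨P.erase c, insert c (M.erase a), ?_, ?_, ?_⟩
        · rw [Finset.disjoint_left] at hPM ⊢
          intro j
          have := @hPM j
          simp only [Finset.mem_erase, Finset.mem_insert]
          tauto
        · have := Finset.card_erase_add_one hc
          rw [Finset.card_insert_of_notMem hcM]
          omega
        · have h1 : f (T \ g) ≤
              f ((P.erase c ∪ insert c (M.erase a)).biUnion S \ g) := by
            refine hmono (hTe.trans (Finset.sdiff_subset_sdiff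
              (Finset.biUnion_subset_biUnion_of_subset_left S fun j => ?_) le_rfl))
            simp only [Finset.mem_union, Finset.mem_erase, Finset.mem_insert]
            tauto
          rw [Finset.sum_insert hcM]
          have h2 := hle c (by simp [hc])
          have h3 := hmono (Finset.sdiff_subset : S c \ g ⊆ S c)
          linarith [hpos (S a)]
  · -- two sets cover the trace of `g`
    by_cases hsing : ∃ a, P ∪ M = {a}
    · obtain ⟨a, hPMa⟩ := hsing
      refine ⟨∅, ∅, by simp, by simp, ?_⟩
      have h1 : f T ≤ f g := by
        have := hle a (by simp [hPMa])
        simpa [hT, hPMa] using this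
      have h2 : 0 ≤ ∑ j ∈ M, f (S j) := Finset.sum_nonneg fun j _ => hpos _
      simp [hempty]
      linarith [hpos T]
    obtain ⟨a, ha, b, hb, hab, hgab⟩ : ∃ a ∈ P ∪ M, ∃ b ∈ P ∪ M, a ≠ b ∧
        T ∩ g ⊆ S a ∪ S b := by
      obtain ⟨a, ha, b, hb, h⟩ := hcov
      rw [Finset.inter_comm] at h
      by_cases hab : a = b
      · subst hab
        obtain ⟨c, hc, hca⟩ : ∃ c ∈ P ∪ M, c ≠ a := by
          by_contra! hno
          exact hsing ⟨a, Finset.eq_singleton_iff_unique_mem.2 ⟨ha, hno⟩⟩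
        exact ⟨a, ha, c, hc, hca.symm, h.trans (by simp)⟩
      · exact ⟨a, ha, b, hb, hab, h⟩
    -- exactly one of the two sets is marked
    have mixed : ∀ a b, a ∈ M → b ∈ P → T ∩ g ⊆ S a ∪ S b →
        ∃ P' M' : Finset ι, Disjoint P' M' ∧ 2 * P'.card + M'.card ≤ 2 * r ∧
          3 / 4 * f T - 1 / 4 * ∑ j ∈ M, f (S j) ≤
            f g + (3 / 4 * f ((P' ∪ M').biUnion S \ g)
              - 1 / 4 * ∑ j ∈ M', f (S j \ g)) := by
      intro a b ha hb hgab
      have hbM : b ∉ M.erase a := fun h =>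
        Finset.disjoint_left.1 hPM hb (Finset.mem_of_mem_erase h)
      have hcb := Finset.card_erase_add_one hb
      have hca := Finset.card_erase_add_one ha
      have h1 : f (T \ g) ≤
          f ((P.erase b ∪ insert b (M.erase a)).biUnion S \ g) + f (S a \ g) := by
        refine hcover (biUnion_sdiff_subset_union fun j => ?_)
        simp only [Finset.mem_union, Finset.mem_erase, Finset.mem_insert]
        tauto
      have h2 : f (T \ g) ≤ f ((P.erase b ∪ M).biUnion S \ g) + f (S b \ g) := by
        refine hcover (biUnion_sdiff_subset_union fun j => ?_)
        simp only [Finset.mem_union, Finset.mem_erase]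
        tauto
      have h3 : f (T ∩ g) ≤ f (S a ∩ g) + f (S b ∩ g) := by
        apply hcover
        intro x hx
        have hxab := hgab hx
        simp only [Finset.mem_inter, Finset.mem_union] at hx hxab ⊢
        tauto
      have hsum := Finset.add_sum_erase M (fun j => f (S j)) ha
      have hsum' := Finset.add_sum_erase M (fun j => f (S j \ g)) ha
      have hd := hdefect (M.erase a)
      have hla := hle a (by simp [ha])
      have hlb := hle b (by simp [hb])
      have hsa := hsplit (S a)
      have hsb := hsplit (S b)
      by_cases hopt : 3 / 4 * f T - 1 / 4 * ∑ j ∈ M, f (S j) ≤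
            f g + (3 / 4 * f ((P.erase b ∪ M).biUnion S \ g)
              - 1 / 4 * ∑ j ∈ M, f (S j \ g))
      · exact ⟨P.erase b, M, hPM.mono_left (Finset.erase_subset _ _), by omega, hopt⟩
      · refine ⟨P.erase b, insert b (M.erase a), ?_, ?_, ?_⟩
        · rw [Finset.disjoint_left] at hPM ⊢
          intro j
          have := @hPM j
          simp only [Finset.mem_erase, Finset.mem_insert]
          tauto
        · rw [Finset.card_insert_of_notMem hbM]
          omega
        · rw [Finset.sum_insert hbM]
          linarith
    rcases Finset.mem_union.1 ha with haP | haM <;> rcases Finset.mem_union.1 hb with hbP | hbM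
    · have haM : a ∉ M := Finset.disjoint_left.1 hPM haP
      have hbM : b ∉ M := Finset.disjoint_left.1 hPM hbP
      have haM' : a ∉ insert b M := by simp [hab, haM]
      have hbP' : b ∈ P.erase a := by simp [hab.symm, hbP]
      refine ⟨(P.erase a).erase b, insert a (insert b M), ?_, ?_, ?_⟩
      · rw [Finset.disjoint_left] at hPM ⊢
        intro j
        have := @hPM j
        simp only [Finset.mem_erase, Finset.mem_insert]
        tauto
      · rw [Finset.card_insert_of_notMem haM', Finset.card_insert_of_notMem hbM]
        have := Finset.card_erase_add_one hbP'
        have := Finset.card_erase_add_one haP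
        omega
      · rw [Finset.sum_insert haM', Finset.sum_insert hbM]
        have h1 : f (T \ g) ≤
            f (((P.erase a).erase b ∪ insert a (insert b M)).biUnion S \ g) := by
          refine hmono (Finset.sdiff_subset_sdiff
            (Finset.biUnion_subset_biUnion_of_subset_left S fun j => ?_) le_rfl)
          simp only [Finset.mem_union, Finset.mem_erase, Finset.mem_insert]
          tauto
        have h3 : f (T ∩ g) ≤ f (S a ∩ g) + f (S b ∩ g) := by
          apply hcover
          intro x hx
          have hxab := hgab hx
          simp only [Finset.mem_inter, Finset.mem_union] at hx hxab ⊢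
          tauto
        have hd := hdefect M
        have hla := hle a ha
        have hlb := hle b hb
        have hsa := hsplit (S a)
        have hsb := hsplit (S b)
        linarith
    · exact mixed b a hbM haP (by rwa [Finset.union_comm])
    · exact mixed a b haM hbP hgab
    · have hbM' : b ∈ M.erase a := by simp [hab.symm, hbM]
      have hsum := Finset.add_sum_erase M (fun j => f (S j)) haM
      have hsum' := Finset.add_sum_erase (M.erase a) (fun j => f (S j)) hbM'
      refine ⟨P, (M.erase a).erase b, ?_, ?_, ?_⟩
      · rw [Finset.disjoint_left] at hPM ⊢
        intro j
        have := @hPM j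
        simp only [Finset.mem_erase]
        tauto
      · have := Finset.card_erase_add_one hbM'
        have := Finset.card_erase_add_one haM
        omega
      · have h1 : f T ≤ f ((P ∪ (M.erase a).erase b).biUnion S \ g) + f (S a ∪ S b) := by
          refine hcover fun x hx => ?_
          by_cases hxg : x ∈ g
          · exact Finset.mem_union_right _ (hgab (Finset.mem_inter.2 ⟨hx, hxg⟩))
          obtain ⟨j, hj, hxj⟩ := Finset.mem_biUnion.1 hx
          by_cases hja : j = a
          · subst hja; simp [hxj]
          by_cases hjb : j = b
          · subst hjb; simp [hxj]
          refine Finset.mem_union_left _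
            (Finset.mem_sdiff.2 ⟨Finset.mem_biUnion.2 ⟨j, ?_, hxj⟩, hxg⟩)
          simp only [Finset.mem_union, Finset.mem_erase] at hj ⊢
          tauto
        have h2 := hunion (S a) (S b)
        have hd := hdefect ((M.erase a).erase b)
        have hla := hle a ha
        have hlb := hle b hb
        linarith

/-- Among halfplanes `α i * u + β i * v ≥ δ i` with `β i > 0`, either one is redundant given the
halfplane `u ≥ b`, or a single one covers everything they cover inside `u ≥ b`. -/
theorem exists_redundant_or_cover_of_pos {ι X : Type*} (s : Finset ι) (hs : s.Nonempty)
    (u v : X → ℝ) (b : ℝ) (α β δ : ι → ℝ) :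
    (∃ i ∈ s, ∃ j ∈ s, i ≠ j ∧
      ∀ x, δ i ≤ α i * u x + β i * v x → b ≤ u x ∨ δ j ≤ α j * u x + β j * v x) ∨
    ∃ j ∈ s, ∀ i ∈ s, 0 < β i → ∀ x, b ≤ u x →
      δ i ≤ α i * u x + β i * v x → δ j ≤ α j * u x + β j * v x := by
  classical
  rcases (s.filter fun i => 0 < β i).eq_empty_or_nonempty with he | hne
  · obtain ⟨j, hj⟩ := hs
    refine Or.inr ⟨j, hj, fun i hi hβ => ?_⟩
    exact absurd hβ (Finset.filter_eq_empty_iff.1 he hi)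
  obtain ⟨j, hj, hmin⟩ := Finset.exists_min_image _ (fun i => (δ i - α i * b) / β i) hne
  obtain ⟨hjs, hβj⟩ := Finset.mem_filter.1 hj
  have hiff : ∀ i, 0 < β i → ∀ x, δ i ≤ α i * u x + β i * v x ↔
      (δ i - α i * b) / β i ≤ α i / β i * (u x - b) + v x := by
    intro i hi x
    rw [div_le_iff₀ hi]
    have : (α i / β i * (u x - b) + v x) * β i = α i * (u x - b) + β i * v x := by
      field_simp
    rw [this]
    constructor <;> intro h <;> linarith
  by_cases h : ∃ i ∈ s, i ≠ j ∧ 0 < β i ∧ α j / β j ≤ α i / β i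
  · obtain ⟨i, hi, hij, hβi, hslope⟩ := h
    refine Or.inl ⟨i, hi, j, hjs, hij, fun x hx => ?_⟩
    by_cases hu : b ≤ u x
    · exact Or.inl hu
    · right
      have hm := hmin i (Finset.mem_filter.2 ⟨hi, hβi⟩)
      rw [hiff i hβi] at hx
      rw [hiff j hβj]
      push Not at hu
      nlinarith
  · push Not at h
    refine Or.inr ⟨j, hjs, fun i hi hβi x hu hx => ?_⟩
    by_cases hij : i = j
    · exact hij ▸ hx
    · have hm := hmin i (Finset.mem_filter.2 ⟨hi, hβi⟩)
      have hslope := h i hi hij hβi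
      rw [hiff i hβi] at hx
      rw [hiff j hβj]
      nlinarith

/-- Given a halfplane `H` and finitely many halfplanes, either one of the latter lies in the union
of `H` and the others, or two of them cover all that they cover inside `H`. -/
theorem exists_redundant_or_two_cover {ι : Type*} (s : Finset ι) (hs : s.Nonempty)
    (a : ℝ × ℝ) (b : ℝ) (c : ι → ℝ × ℝ) (d : ι → ℝ) :
    (∃ i ∈ s, ∀ x : ℝ × ℝ, d i ≤ (c i).1 * x.1 + (c i).2 * x.2 →
      b ≤ a.1 * x.1 + a.2 * x.2 ∨ ∃ j ∈ s, i ≠ j ∧ d j ≤ (c j).1 * x.1 + (c j).2 * x.2) ∨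
    ∃ j ∈ s, ∃ l ∈ s, ∀ i ∈ s, ∀ x : ℝ × ℝ, b ≤ a.1 * x.1 + a.2 * x.2 →
      d i ≤ (c i).1 * x.1 + (c i).2 * x.2 →
      d j ≤ (c j).1 * x.1 + (c j).2 * x.2 ∨ d l ≤ (c l).1 * x.1 + (c l).2 * x.2 := by
  by_cases ha : a = 0
  · obtain ⟨j, hj⟩ := hs
    by_cases hb : b ≤ 0
    · exact Or.inl ⟨j, hj, fun x _ => Or.inl (by simpa [ha] using hb)⟩
    · refine Or.inr ⟨j, hj, j, hj, fun i _ x hx => absurd hx ?_⟩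
      simpa [ha] using hb
  have hN : 0 < a.1 ^ 2 + a.2 ^ 2 := by
    by_contra! h
    apply ha
    have h1 : a.1 = 0 := by nlinarith [sq_nonneg a.1, sq_nonneg a.2]
    have h2 : a.2 = 0 := by nlinarith [sq_nonneg a.1, sq_nonneg a.2]
    exact Prod.ext h1 h2
  set N := a.1 ^ 2 + a.2 ^ 2 with hNdef
  obtain ⟨u, hu⟩ : ∃ u : ℝ × ℝ → ℝ, ∀ x, u x = a.1 * x.1 + a.2 * x.2 := ⟨_, fun _ => rfl⟩
  obtain ⟨v, hv⟩ : ∃ v : ℝ × ℝ → ℝ, ∀ x, v x = a.1 * x.2 - a.2 * x.1 := ⟨_, fun _ => rfl⟩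
  obtain ⟨α, hα⟩ : ∃ α : ι → ℝ, ∀ i, α i = (c i).1 * a.1 + (c i).2 * a.2 := ⟨_, fun _ => rfl⟩
  obtain ⟨β, hβ⟩ : ∃ β : ι → ℝ, ∀ i, β i = a.1 * (c i).2 - a.2 * (c i).1 := ⟨_, fun _ => rfl⟩
  have hiff : ∀ i x, d i ≤ (c i).1 * x.1 + (c i).2 * x.2 ↔
      N * d i ≤ α i * u x + β i * v x := by
    intro i x
    have : α i * u x + β i * v x = N * ((c i).1 * x.1 + (c i).2 * x.2) := by
      rw [hα, hβ, hu, hv, hNdef]; ring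
    rw [this, mul_le_mul_iff_right₀ hN]
  simp only [hiff, ← hu]
  rcases exists_redundant_or_cover_of_pos s hs u v b α β (fun i => N * d i) with
    ⟨i, hi, j, hj, hij, h⟩ | ⟨j, hj, hpos⟩
  · exact Or.inl ⟨i, hi, fun x hx => (h x hx).imp_right fun h' => ⟨j, hj, hij, h'⟩⟩
  rcases exists_redundant_or_cover_of_pos s hs u (fun x => -v x) b α (fun i => -β i)
    (fun i => N * d i) with ⟨i, hi, j, hj, hij, h⟩ | ⟨l, hl, hneg⟩
  · simp only [neg_mul_neg] at h
    exact Or.inl ⟨i, hi, fun x hx => (h x hx).imp_right fun h' => ⟨j, hj, hij, h'⟩⟩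
  simp only [neg_mul_neg, neg_pos] at hneg
  by_contra! hcon
  obtain ⟨hred, hcov⟩ := hcon
  obtain ⟨i, hi, x, hxb, hxi, hxj, hxl⟩ := hcov j hj l hl
  rcases lt_trichotomy (β i) 0 with hβi | hβi | hβi
  · exact absurd (hneg i hi hβi x hxb hxi) (not_le.2 hxl)
  · obtain ⟨y, hyi, hyb, hyj⟩ := hred i hi
    rw [hβi] at hxi hyi
    rcases le_or_gt 0 (α i) with hαi | hαi
    · obtain ⟨m, hm, z, hzb, -, hzi, -⟩ := hcov i hi i hi
      rw [hβi] at hzi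
      nlinarith
    · have hij : j ≠ i := by
        rintro rfl
        rw [hβi] at hxj
        linarith
      obtain ⟨z, hzj, hzb, hz⟩ := hred j hj
      have := hz i hi hij
      rw [hβi] at this
      nlinarith
  · exact absurd (hpos i hi hβi x hxb hxi) (not_le.2 hxj)

/-- for weighted Maximum Coverage with two-dimensional halfplanes,
the greedy algorithm achieves at least `3/4` of the optimum weight. -/
theorem statement14 (U : Finset (ℝ × ℝ)) (𝓡 : Finset (Finset (ℝ × ℝ)))
    (h𝓡 : 𝓡.Nonempty) (hsub : ∀ R ∈ 𝓡, R ⊆ U)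
    (hhalf : ∀ R ∈ 𝓡, ∃ (a : ℝ × ℝ) (b : ℝ),
      ∀ x, x ∈ R ↔ x ∈ U ∧ a.1 * x.1 + a.2 * x.2 ≥ b)
    (k : ℕ) (hk : 1 ≤ k) (w : ℝ × ℝ → ℝ) (hw : ∀ x, 0 ≤ w x)
    (g : Fin k → Finset (ℝ × ℝ)) (hgmem : ∀ i, g i ∈ 𝓡)
    (hgreedy : ∀ i, ∀ T ∈ 𝓡,
      ∑ x ∈ T \ (Finset.Iio i).sup g, w x ≤ ∑ x ∈ g i \ (Finset.Iio i).sup g, w x) :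
    ∀ S : Fin k → Finset (ℝ × ℝ), (∀ i, S i ∈ 𝓡) →
      ∑ x ∈ Finset.univ.sup g, w x ≥ (3 / 4) * ∑ x ∈ Finset.univ.sup S, w x := by
  intro S hS
  set G : ℕ → Finset (ℝ × ℝ) := fun t => (Finset.univ.filter fun i : Fin k => i.val < t).sup g
    with hG
  have hgeo : ∀ t : Fin k, ∀ s : Finset (Fin k), s.Nonempty →
      (∃ j ∈ s, S j ⊆ g t ∪ (s.erase j).biUnion S) ∨
        ∃ a ∈ s, ∃ b ∈ s, g t ∩ s.biUnion S ⊆ S a ∪ S b := by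
    intro t s hs
    obtain ⟨a, b, hab⟩ := hhalf _ (hgmem t)
    choose c d hcd using fun i => hhalf _ (hS i)
    rcases exists_redundant_or_two_cover s hs a b c d with ⟨i, hi, h⟩ | ⟨j, hj, l, hl, h⟩
    · refine Or.inl ⟨i, hi, fun x hx => ?_⟩
      obtain ⟨hxU, hx⟩ := (hcd i x).1 hx
      rcases h x hx with h | ⟨j, hj, hij, h⟩
      · exact Finset.mem_union_left _ ((hab x).2 ⟨hxU, h⟩)
      · exact Finset.mem_union_right _ (Finset.mem_biUnion.2
          ⟨j, Finset.mem_erase.2 ⟨hij.symm, hj⟩, (hcd j x).2 ⟨hxU, h⟩⟩)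
    · refine Or.inr ⟨j, hj, l, hl, fun x hx => ?_⟩
      obtain ⟨hxg, hxS⟩ := Finset.mem_inter.1 hx
      obtain ⟨i, hi, hxi⟩ := Finset.mem_biUnion.1 hxS
      obtain ⟨hxU, hxi⟩ := (hcd i x).1 hxi
      rcases h i hi x ((hab x).1 hxg).2 hxi with h | h
      · exact Finset.mem_union_left _ ((hcd j x).2 ⟨hxU, h⟩)
      · exact Finset.mem_union_right _ ((hcd l x).2 ⟨hxU, h⟩)
  have key : ∀ r t : ℕ, t + r = k → ∀ P M : Finset (Fin k), Disjoint P M →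
      2 * P.card + M.card ≤ 2 * r →
      ∑ x ∈ G t, w x + (3 / 4 * ∑ x ∈ (P ∪ M).biUnion S \ G t, w x
        - 1 / 4 * ∑ j ∈ M, ∑ x ∈ S j \ G t, w x) ≤ ∑ x ∈ G k, w x := by
    intro r
    induction r with
    | zero =>
      intro t ht P M _ hr
      have hP : P = ∅ := Finset.card_eq_zero.1 (by omega)
      have hM : M = ∅ := Finset.card_eq_zero.1 (by omega)
      subst hP hM
      have : t = k := by omega
      simp [this]
    | succ r ih =>
      intro t ht P M hPM hr
      obtain ⟨i, hi⟩ : ∃ i : Fin k, i.val = t := ⟨⟨t, by omega⟩, rfl⟩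
      have hIio : (Finset.Iio i).sup g = G t := by
        rw [hG, ← hi]
        congr 1
        ext j
        simp only [Finset.mem_Iio, Finset.mem_filter, Finset.mem_univ, true_and, Fin.lt_def]
      have hGsucc : G (t + 1) = G t ∪ g i := by
        have : (Finset.univ.filter fun j : Fin k => j.val < t + 1) =
            insert i (Finset.univ.filter fun j : Fin k => j.val < t) := by
          ext j
          simp only [Finset.mem_filter, Finset.mem_univ, true_and, Finset.mem_insert, Fin.ext_iff]
          omega
        simp only [hG]
        rw [this, Finset.sup_insert, Finset.sup_eq_union, Finset.union_comm]
      have hGsum : ∑ x ∈ G (t + 1), w x = ∑ x ∈ G t, w x + ∑ x ∈ g i \ G t, w x := by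
        rw [hGsucc, ← Finset.union_sdiff_self_eq_union,
          Finset.sum_union Finset.disjoint_sdiff]
      have hsd : ∀ X : Finset (ℝ × ℝ), (X \ G t) \ (g i \ G t) = X \ G (t + 1) := by
        intro X
        rw [hGsucc]
        ext x
        simp only [Finset.mem_sdiff, Finset.mem_union]
        tauto
      have hbi : ∀ s : Finset (Fin k), s.biUnion (fun j => S j \ G t) = s.biUnion S \ G t := by
        intro s
        ext x
        simp only [Finset.mem_sdiff, Finset.mem_biUnion]
        grind
      rcases (P ∪ M).eq_empty_or_nonempty with he | hne
      · obtain ⟨rfl, rfl⟩ := Finset.union_eq_empty.1 he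
        have := ih (t + 1) (by omega) ∅ ∅ (by simp) (by simp)
        simp only [Finset.union_empty, Finset.biUnion_empty, Finset.empty_sdiff,
          Finset.sum_empty] at this ⊢
        have h0 : 0 ≤ ∑ x ∈ g i \ G t, w x := Finset.sum_nonneg fun x _ => hw x
        linarith
      obtain ⟨P', M', hPM', hr', hstep⟩ := exists_greedy_step (fun j => S j \ G t) (g i \ G t) w hw
        P M hPM r hr (fun j _ => by simpa only [hIio] using hgreedy i _ (hS j)) (by
          simp only [hbi]
          rcases hgeo i _ hne with ⟨j, hj, h⟩ | ⟨a, ha, b, hb, h⟩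
          · refine Or.inl ⟨j, hj, ?_⟩
            rw [← Finset.union_sdiff_distrib]
            exact Finset.sdiff_subset_sdiff h le_rfl
          · refine Or.inr ⟨a, ha, b, hb, ?_⟩
            rw [← Finset.union_sdiff_distrib, ← Finset.inf_eq_inter, ← inf_sdiff]
            exact Finset.sdiff_subset_sdiff h le_rfl)
      simp only [hbi, hsd] at hstep
      have := ih (t + 1) (by omega) P' M' hPM' hr'
      linarith
  have h := key k 0 (by omega) Finset.univ ∅ (by simp) (by simp)
  have hG0 : G 0 = ∅ := by simp [hG]
  have hGk : G k = Finset.univ.sup g := by simp [hG]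
  rw [hG0, hGk] at h
  simpa [Finset.sup_eq_biUnion] using h
end

section
/- There exists an instance of (unweighted) two-dimensional Maximum Halfspace Coverage with k = 2 on which some valid execution of the greedy algorithm achieves exactly 3/4 of the optimum. Concretely: there exist four distinct points p₁, p₂, p₃, p₄ ∈ ℝ² and three closed halfplanes h₁, h₂, h₃ with h₁ ∩ {p₁,p₂,p₃,p₄} = {p₁, p₂}, h₂ ∩ {p₁,p₂,p₃,p₄} = {p₃, p₄}, and h₃ ∩ {p₁,p₂,p₃,p₄} = {p₁, p₃}, so that with 𝓡 = {h₁ ∩ U, h₂ ∩ U, h₃ ∩ U} for U = {p₁,p₂,p₃,p₄}: the optimal pair (h₁, h₂) covers 4 points, while the sequence (h₃, h₁) is a valid greedy execution (each chosen set covers at least as many new points as any set in 𝓡) covering only 3 points. -/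
/-- a tight example for greedy on two-dimensional halfspaces with
`k = 2`: four distinct points and three halfplane-induced sets
`s₀ = {p₁,p₂}`, `s₁ = {p₃,p₄}`, `s₂ = {p₁,p₃}` such that the optimal pair
`(s₀, s₁)` covers 4 points while `(s₂, s₀)` is a valid greedy execution covering
only 3 points. -/
theorem statement15 :
    ∃ (p₁ p₂ p₃ p₄ : ℝ × ℝ) (a : Fin 3 → ℝ × ℝ) (b : Fin 3 → ℝ)
      (s : Fin 3 → Finset (ℝ × ℝ)),
      (p₁ ≠ p₂ ∧ p₁ ≠ p₃ ∧ p₁ ≠ p₄ ∧ p₂ ≠ p₃ ∧ p₂ ≠ p₄ ∧ p₃ ≠ p₄) ∧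
      (∀ i x, x ∈ s i ↔
        x ∈ ({p₁, p₂, p₃, p₄} : Finset (ℝ × ℝ)) ∧
          (a i).1 * x.1 + (a i).2 * x.2 ≥ b i) ∧
      s 0 = {p₁, p₂} ∧ s 1 = {p₃, p₄} ∧ s 2 = {p₁, p₃} ∧
      (s 0 ∪ s 1).card = 4 ∧
      (∀ j : Fin 3, (s j).card ≤ (s 2).card) ∧
      (∀ j : Fin 3, (s j \ s 2).card ≤ (s 0 \ s 2).card) ∧
      (s 2 ∪ s 0).card = 3 := by
  refine ⟨(0, 0), (0, 1), (1, 0), (1, 1), ![(-1, 0), (1, 0), (0, -1)], ![0, 1, 0],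
    ![{(0, 0), (0, 1)}, {(1, 0), (1, 1)}, {(0, 0), (1, 0)}],
    by simp, ?_, rfl, rfl, rfl, ?_, ?_, ?_, ?_⟩
  · intro i x
    fin_cases i <;> constructor <;> simp only [Finset.mem_insert, Finset.mem_singleton] <;> simp
    iterate 3
      · rintro (rfl | rfl) <;> norm_num
      · rintro (rfl | rfl | rfl | rfl) <;> norm_num
  · simp [Finset.card_insert_of_notMem]
  · intro j
    fin_cases j <;> simp [Finset.card_insert_of_notMem]
  · intro j
    fin_cases j <;> simp [Finset.insert_sdiff_of_mem, Finset.sdiff_eq_self_of_disjoint]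
  · simp [Finset.card_insert_of_notMem]
end
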